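/- Let φ : [0,∞) → [0,∞) satisfy φ(t) = o(t^{1/3}) as t → ∞. Then the set of irrational numbers θ such that the irrational rotation R_θ is φ-integrably orbit equivalent to the universal odometer is dense in ℝ. -/

import Mathlib

/-- A measure-theoretic dynamical system: an invertible bimeasurable transformation
of a measure space. -/
structure MSystem where
  carrier : Type
  [meas : MeasurableSpace carrier]
  μ : MeasureTheory.Measure carrier
  T : carrier ≃ᵐ carrier

attribute [instance] MSystem.meas

open MeasureTheory Filter Set Topology

/-- A cutting and spacing parameter: an integer `q ≥ 2` (the cutting parameter) together
with nonnegative integers `σ 0, …, σ q` (the spacing parameters), represented as a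
function `ℕ → ℕ` vanishing above `q`. -/
structure CSParam where
  q : ℕ
  two_le_q : 2 ≤ q
  σ : ℕ → ℕ
  σ_eq_zero_of_gt : ∀ i, q < i → σ i = 0

/-- The total number `σ_n = σ_{n,0} + ⋯ + σ_{n,q_n}` of spacers added at one step. -/
def CSParam.σtot (P : CSParam) : ℕ := ∑ i ∈ Finset.range (P.q + 1), P.σ i

/-- The height sequence associated with a sequence of cutting and spacing parameters:
`h 0 = 1` and `h (n+1) = q_n · h_n + σ_n`. -/
def heights (p : ℕ → CSParam) : ℕ → ℕ
  | 0 => 1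
  | n + 1 => (p n).q * heights p n + (p n).σtot

/-- `Z_n`, the maximum spacing parameter over the first `n+1` steps. -/
def Zmax (p : ℕ → CSParam) (n : ℕ) : ℕ :=
  (Finset.range (n + 1)).sup fun j => (Finset.range ((p j).q + 1)).sup (p j).σ

/-- Condition (F): the series `Σ σ_n / h_{n+1}` converges. -/
def CondF (p : ℕ → CSParam) : Prop :=
  Summable fun n => ((p n).σtot : ℝ) / (heights p (n + 1) : ℝ)

/-- The level of the `(n+1)`-th tower at which the `i`-th subcolumn of the `n`-th
tower starts, namely `σ_{n,0} + ⋯ + σ_{n,i} + i·h_n`. -/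
def colStart (p : ℕ → CSParam) (n i : ℕ) : ℕ :=
  (∑ j ∈ Finset.range (i + 1), (p n).σ j) + i * heights p n

/-- The subset `X_n` covered by the `n`-th tower. -/
def towerUnion {X : Type} [MeasurableSpace X] (T : X ≃ᵐ X) (p : ℕ → CSParam)
    (B : ℕ → Set X) (n : ℕ) : Set X :=
  ⋃ k ∈ Finset.range (heights p n), (⇑T)^[k] '' B n

/-- A cutting-and-stacking tower structure for `T`, with parameters `p`, bases `B n`
(so that the `n`-th tower has levels `T^k (B n)`, `k < h_n`), and subdivision
`Bsub n 0, …, Bsub n (q_n - 1)` of `B n`: the `(n+1)`-th tower is obtained by stacking,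
in order, `σ_{n,0}` spacer levels, the subcolumn over `Bsub n 0`, `σ_{n,1}` spacer levels,
…, the subcolumn over `Bsub n (q_n-1)`, and `σ_{n,q_n}` spacer levels on top, the spacer
levels being disjoint from `X_n`. -/
structure IsCuttingStacking {X : Type} [MeasurableSpace X] (T : X ≃ᵐ X)
    (p : ℕ → CSParam) (B : ℕ → Set X) (Bsub : ℕ → ℕ → Set X) : Prop where
  meas_base : ∀ n, MeasurableSet (B n)
  meas_sub : ∀ n, ∀ i < (p n).q, MeasurableSet (Bsub n i)
  disj_levels : ∀ n, ∀ k < heights p n, ∀ l < heights p n, k ≠ l →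
    Disjoint ((⇑T)^[k] '' B n) ((⇑T)^[l] '' B n)
  disj_sub : ∀ n, ∀ i < (p n).q, ∀ j < (p n).q, i ≠ j → Disjoint (Bsub n i) (Bsub n j)
  union_sub : ∀ n, B n = ⋃ i ∈ Finset.range (p n).q, Bsub n i
  subcolumn : ∀ n, ∀ i < (p n).q, ∀ k < heights p n,
    (⇑T)^[colStart p n i + k] '' B (n + 1) = (⇑T)^[k] '' Bsub n i
  spacer_disjoint : ∀ n, ∀ l < heights p (n + 1),
    (∀ i < (p n).q, ∀ k < heights p n, l ≠ colStart p n i + k) →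
    Disjoint ((⇑T)^[l] '' B (n + 1)) (towerUnion T p B n)

/-- The towers with bases `B n` increase to the full σ-algebra modulo `μ`-null sets. -/
def TowersGenerate {X : Type} [MeasurableSpace X] (μ : Measure X) (T : X ≃ᵐ X)
    (p : ℕ → CSParam) (B : ℕ → Set X) : Prop :=
  ∀ A : Set X, MeasurableSet A → ∃ A' : Set X,
    MeasurableSet[MeasurableSpace.generateFrom
      {s : Set X | ∃ n k, k < heights p n ∧ s = (⇑T)^[k] '' B n}] A' ∧
    μ (symmDiff A A') = 0

/-- `T` is a rank-one system with cutting and spacing parameters `p` on `(X, μ)`. -/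
def IsRankOneWith {X : Type} [MeasurableSpace X] (μ : Measure X) (T : X ≃ᵐ X)
    (p : ℕ → CSParam) : Prop :=
  MeasurePreserving T μ μ ∧ CondF p ∧
    ∃ B Bsub, IsCuttingStacking T p B Bsub ∧ TowersGenerate μ T p B

/-- `T` is a rank-one system on `(X, μ)`. -/
def IsRankOne {X : Type} [MeasurableSpace X] (μ : Measure X) (T : X ≃ᵐ X) : Prop :=
  ∃ p, IsRankOneWith μ T p

/-- Iterates, indexed by `ℤ`, of a measurable equivalence. -/
def zIter {X : Type} [MeasurableSpace X] (T : X ≃ᵐ X) (n : ℤ) (x : X) : X :=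
  if 0 ≤ n then (⇑T)^[n.toNat] x else (⇑T.symm)^[(-n).toNat] x

/-- The `T`-orbit of a point. -/
def orbit {X : Type} [MeasurableSpace X] (T : X ≃ᵐ X) (x : X) : Set X :=
  Set.range fun n : ℤ => zIter T n x

/-- `S` is the universal odometer: a rank-one system admitting a construction with no
spacers whose cutting parameters `q'_n` are such that every positive integer divides
some product `q'_0 ⋯ q'_{n-1}`. -/
def IsUniversalOdometer {X : Type} [MeasurableSpace X] (μ : Measure X) (S : X ≃ᵐ X) : Prop :=
  ∃ p : ℕ → CSParam, IsRankOneWith μ S p ∧ (∀ n i, (p n).σ i = 0) ∧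
    ∀ N : ℕ, 0 < N → ∃ n, N ∣ ∏ k ∈ Finset.range n, (p k).q

/-- `T` (acting on `(X,μ)`) and `S` (acting on `(Y,ν)`) are φ-integrably orbit
equivalent: there is a measure-preserving bimeasurable bijection matching a.e. `T`-orbit
with the corresponding `S`-orbit, whose cocycles `c_T`, `c_S` satisfy
`∫ φ(|c_T|) dμ < ∞` and `∫ φ(|c_S|) dν < ∞`. -/
def PhiIntegrablyOE {X Y : Type} [MeasurableSpace X] [MeasurableSpace Y]
    (μ : Measure X) (T : X ≃ᵐ X) (ν : Measure Y) (S : Y ≃ᵐ Y) (φ : ℝ → ℝ) : Prop :=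
  ∃ Ψ : X ≃ᵐ Y, MeasurePreserving Ψ μ ν ∧
    (∀ᵐ x ∂μ, Ψ '' orbit T x = orbit S (Ψ x)) ∧
    ∃ cT : X → ℤ, ∃ cS : Y → ℤ,
      Measurable cT ∧ Measurable cS ∧
      (∀ᵐ x ∂μ, Ψ (T x) = zIter S (cT x) (Ψ x)) ∧
      (∀ᵐ y ∂ν, Ψ.symm (S y) = zIter T (cS y) (Ψ.symm y)) ∧
      Integrable (fun x => φ |(cT x : ℝ)|) μ ∧
      Integrable (fun y => φ |(cS y : ℝ)|) ν

/-- The underlying space is a standard atomless probability space. -/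
def MSystem.Standard (𝒮 : MSystem) : Prop :=
  StandardBorelSpace 𝒮.carrier ∧ IsProbabilityMeasure 𝒮.μ ∧ NoAtoms 𝒮.μ

/-- `T` is φ-integrably orbit equivalent to the universal odometer. -/
def PhiOEToUnivOdometer {X : Type} [MeasurableSpace X] (μ : Measure X) (T : X ≃ᵐ X)
    (φ : ℝ → ℝ) : Prop :=
  ∃ 𝒮 : MSystem, 𝒮.Standard ∧ IsUniversalOdometer 𝒮.μ 𝒮.T ∧
    PhiIntegrablyOE μ T 𝒮.μ 𝒮.T φ

/-- `φ(t) = o(t^{1/3})` as `t → ∞`. -/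
def SmallOCbrt (φ : ℝ → ℝ) : Prop :=
  Tendsto (fun t : ℝ => φ t / t ^ ((1 : ℝ) / 3)) atTop (nhds 0)

/-- The rotation of angle `θ` on the circle `ℝ/ℤ` (equipped with its Haar probability
measure `volume`), as a measurable equivalence. -/
noncomputable def rot (θ : ℝ) : AddCircle (1 : ℝ) ≃ᵐ AddCircle (1 : ℝ) :=
  MeasurableEquiv.addLeft (θ : AddCircle (1 : ℝ))

/-- Arithmetic data approximating `θ` by the fractions `P n / Q n`: consecutive fractions have
determinant one, `Q n = H n + v n` where `H n` will be the height of an odometer tower inside a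
Rokhlin tower of height `Q n`, and the quotients `H (n + 1) / H n = K n * Q n` grow fast. -/
structure Scheme (θ : ℝ) where
  P : ℕ → ℤ
  Q : ℕ → ℕ
  H : ℕ → ℕ
  K : ℕ → ℕ
  v : ℕ → ℕ
  H_zero : H 0 = 1
  H_succ : ∀ n, H (n + 1) = K n * H n * Q n
  Q_eq : ∀ n, Q n = H n + v n
  v_ge : ∀ n, Q n ≤ v (n + 1)
  v_le : ∀ n, v (n + 1) ≤ 2 * Q n
  det : ∀ n, P (n + 1) * Q n - P n * Q (n + 1) = 1
  dvd : ∀ n, n + 1 ∣ K n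
  K_large : ∀ n, 8 ^ (n + 4) * Q n ^ 2 ≤ K n
  err_pos : ∀ n, 0 < Q n * θ - P n
  err_le : ∀ n, (Q n * θ - P n) * Q (n + 1) ≤ 2

/-- The state of the recursive construction of a `Scheme`. -/
structure SchemeState where
  P : ℤ
  Q : ℕ
  H : ℕ
  H_pos : 0 < H
  H_le : H ≤ Q
  coprime : IsCoprime P (Q : ℤ)

lemma exists_det_one {P : ℤ} {Q : ℕ} (hQ : 0 < Q) (h : IsCoprime P (Q : ℤ)) :
    ∃ (u : ℤ) (v : ℕ), u * Q - P * v = 1 ∧ Q ≤ v ∧ v ≤ 2 * Q := by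
  obtain ⟨a, b, hab⟩ := h
  have hQ' : (0 : ℤ) < Q := by exact_mod_cast hQ
  have h0 := Int.emod_nonneg (-a) hQ'.ne'
  have h1 := Int.emod_lt_of_pos (-a) hQ'
  have h2 := Int.mul_ediv_add_emod (-a) Q
  set r := (-a) % (Q : ℤ)
  set c := (-a) / (Q : ℤ)
  refine ⟨b - P * c + P, (r + Q).toNat, ?_, by omega, by omega⟩
  rw [Int.toNat_of_nonneg (by omega)]
  linear_combination hab - P * h2

lemma exists_next_state (M n : ℕ) (hM : 0 < M) (s : SchemeState) : ∃ t : SchemeState, ∃ v : ℕ,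
    t.H = ((n + 1) * (8 ^ (n + 4) * s.Q ^ 2 * M)) * s.H * s.Q ∧ t.Q = t.H + v ∧
      s.Q ≤ v ∧ v ≤ 2 * s.Q ∧ t.P * s.Q - s.P * t.Q = 1 := by
  have hQ : 0 < s.Q := s.H_pos.trans_le s.H_le
  have hH := s.H_pos
  obtain ⟨u, v, huv, h1, h2⟩ := exists_det_one hQ s.coprime
  set A := ((n + 1) * (8 ^ (n + 4) * s.Q ^ 2 * M)) * s.H with hA
  have hdet : (u + A * s.P) * s.Q - s.P * ((A * s.Q + v : ℕ) : ℤ) = 1 := by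
    push_cast
    linear_combination huv
  exact ⟨⟨u + A * s.P, A * s.Q + v, A * s.Q, by positivity, by omega,
    ⟨s.Q, -s.P, by linear_combination hdet⟩⟩, v, rfl, rfl, h1, h2, hdet⟩

lemma exists_scheme (x : ℝ) {ε : ℝ} (hε : 0 < ε) :
    ∃ θ : ℝ, |θ - x| < ε ∧ Nonempty (Scheme θ) := by
  obtain ⟨r, hr1, hr2⟩ := exists_rat_btwn (show x < x + ε / 2 by linarith)
  obtain ⟨M, hM⟩ := exists_nat_gt (4 / ε)
  have hM0 : 0 < M := by
    have : 0 < 4 / ε := by positivity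
    exact_mod_cast this.trans hM
  choose f g hf1 hf2 hf3 hf4 hf5 using fun n => exists_next_state M n hM0
  let s : ℕ → SchemeState := fun n => Nat.rec
    ⟨r.num, r.den, 1, one_pos, r.den_pos, Rat.isCoprime_num_den r⟩ (fun n t => f n t) n
  have hs : ∀ n, s (n + 1) = f n (s n) := fun _ => rfl
  have Hpos : ∀ n, 0 < (s n).H := fun n => (s n).H_pos
  have Qpos : ∀ n, 0 < (s n).Q := fun n => (Hpos n).trans_le (s n).H_le
  have QposR : ∀ n, (0 : ℝ) < (s n).Q := fun n => by exact_mod_cast Qpos n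
  have hdet : ∀ n, ((s (n + 1)).P : ℝ) * (s n).Q - (s n).P * (s (n + 1)).Q = 1 := fun n => by
    rw [hs]; exact_mod_cast hf5 n (s n)
  have hgrow : ∀ n, 2 * (s n).Q ≤ (s (n + 1)).Q ∧ M ≤ (s (n + 1)).Q := by
    intro n
    have h1 : (s n).Q ^ 2 * (s n).H * (s n).Q * (n + 1) * (8 ^ (n + 4)) * M ≤ (s (n + 1)).Q := by
      rw [hs, hf2, hf1]; nlinarith
    have hQ := Qpos n
    have hH := Hpos n
    have h8 : 2 ≤ 8 ^ (n + 4) := by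
      calc 2 ≤ 8 ^ 1 := by norm_num
        _ ≤ 8 ^ (n + 4) := Nat.pow_le_pow_right (by norm_num) (by omega)
    constructor
    · calc 2 * (s n).Q ≤ 8 ^ (n + 4) * (s n).Q := by gcongr
        _ ≤ 8 ^ (n + 4) * (s n).Q * ((s n).Q ^ 2 * (s n).H * (n + 1) * M) :=
          Nat.le_mul_of_pos_right _ (by positivity)
        _ ≤ _ := by linarith
    · calc M ≤ M * ((s n).Q ^ 2 * (s n).H * (s n).Q * (n + 1) * (8 ^ (n + 4))) :=
          Nat.le_mul_of_pos_right _ (by positivity)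
        _ ≤ _ := by linarith
  let a : ℕ → ℝ := fun n => (s n).P / (s n).Q
  let d : ℕ → ℝ := fun n => 1 / ((s n).Q * (s (n + 1)).Q)
  have ha : ∀ n, a (n + 1) = a n + d n := by
    intro n
    have := hdet n
    have h1 := QposR n
    have h2 := QposR (n + 1)
    simp only [a, d]
    field_simp
    linarith
  have hdpos : ∀ n, 0 < d n := fun n => by
    have h1 := QposR n
    have h2 := QposR (n + 1)
    simp only [d]; positivity
  have hd : ∀ n, 2 * d (n + 1) ≤ d n := by
    intro n
    have h1 := QposR n
    have h2 := QposR (n + 1)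
    have h3 := QposR (n + 2)
    have h4 : (2 : ℝ) * (s n).Q ≤ (s (n + 2)).Q := by
      have e1 := (hgrow n).1
      have e2 : 2 * (s (n + 1)).Q ≤ (s (n + 2)).Q := (hgrow (n + 1)).1
      have : 2 * (s n).Q ≤ (s (n + 2)).Q := by omega
      exact_mod_cast this
    simp only [d]
    rw [mul_one_div, div_le_div_iff₀ (by positivity) (by positivity)]
    nlinarith
  have hanti : Antitone fun n => Icc (a n) (a n + 2 * d n) := antitone_nat_of_succ_le fun n =>
    Icc_subset_Icc (by rw [ha]; linarith [hdpos n]) (by rw [ha]; linarith [hd n])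
  have hmem := mem_iInter.1 (ciSup_mem_iInter_Icc_of_antitone_Icc hanti
    (fun n => by linarith [hdpos n]))
  set θ := ⨆ n, a n
  have hlo : ∀ n, a n < θ := fun n => by linarith [(hmem (n + 1)).1, ha n, hdpos n]
  refine ⟨θ, ?_, ⟨⟨fun n => (s n).P, fun n => (s n).Q, fun n => (s n).H,
    fun n => ((n + 1) * (8 ^ (n + 4) * (s n).Q ^ 2 * M)), fun n => (s n).Q - (s n).H,
    rfl, fun n => ?_, fun n => ?_, fun n => ?_, fun n => ?_, fun n => ?_, fun n => ?_, fun n => ?_,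
    fun n => ?_, fun n => ?_⟩⟩⟩
  · have h1 := hlo 0
    have h2 := (hmem 0).2
    have ha0 : a 0 = r := by
      simp only [a, s]; exact Rat.cast_def r |>.symm
    have hd0 : d 0 ≤ 1 / M := by
      simp only [d]
      have e1 : (M : ℝ) ≤ (s 1).Q := by exact_mod_cast (hgrow 0).2
      have e2 : (1 : ℝ) ≤ (s 0).Q := by exact_mod_cast Qpos 0
      have e3 : (0 : ℝ) < M := by exact_mod_cast hM0
      apply one_div_le_one_div_of_le e3
      calc (M : ℝ) ≤ (s 1).Q := e1
        _ ≤ (s 0).Q * (s 1).Q := le_mul_of_one_le_left (QposR 1).le e2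
    have hMε : 2 * (1 / (M : ℝ)) < ε / 2 := by
      have e3 : (0 : ℝ) < M := by exact_mod_cast hM0
      rw [div_lt_iff₀ hε] at hM
      rw [mul_one_div, div_lt_div_iff₀ e3 two_pos]
      linarith
    rw [abs_lt]
    constructor <;> linarith
  · rw [hs, hf1]
  · have := (s n).H_le
    omega
  · have h2 := hf2 n (s n)
    have h3 := hf3 n (s n)
    simp only [hs]; omega
  · have h2 := hf2 n (s n)
    have h3 := hf4 n (s n)
    simp only [hs]; omega
  · exact_mod_cast hdet n
  · exact Dvd.intro _ rfl
  · calc _ ≤ 8 ^ (n + 4) * (s n).Q ^ 2 * ((n + 1) * M) :=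
        Nat.le_mul_of_pos_right _ (by positivity)
      _ = _ := by ring
  · have := hlo n
    simp only [a] at this
    rw [div_lt_iff₀ (QposR n)] at this
    linarith
  · have := (hmem n).2
    have h1 := QposR n
    have h2 := QposR (n + 1)
    have h3 : (s n).Q * θ - (s n).P ≤ (s n).Q * (2 * d n) := by
      have e : (s n).Q * a n = (s n).P := by simp only [a]; field_simp
      rw [← e]; nlinarith
    calc ((s n).Q * θ - (s n).P) * (s (n + 1)).Q ≤ (s n).Q * (2 * d n) * (s (n + 1)).Q := by
          gcongr
      _ = 2 := by simp only [d]; field_simp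

namespace Scheme

variable {θ : ℝ} (s : Scheme θ)

lemma H_le_Q (n : ℕ) : s.H n ≤ s.Q n := by rw [s.Q_eq]; omega

lemma H_pos (n : ℕ) : 0 < s.H n := by
  induction n with
  | zero => simp [s.H_zero]
  | succ n ih =>
    have hQ := ih.trans_le (s.H_le_Q n)
    have : 0 < s.K n := lt_of_lt_of_le (by positivity) (s.K_large n)
    rw [s.H_succ]; positivity

lemma Q_pos (n : ℕ) : 0 < s.Q n := (s.H_pos n).trans_le (s.H_le_Q n)

lemma Q_growth (n : ℕ) : 8 ^ (n + 4) * s.Q n ^ 3 ≤ s.Q (n + 1) := by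
  calc 8 ^ (n + 4) * s.Q n ^ 3 = 8 ^ (n + 4) * s.Q n ^ 2 * s.Q n := by ring
    _ ≤ s.K n * s.Q n := by gcongr; exact s.K_large n
    _ ≤ s.K n * s.Q n * s.H n := Nat.le_mul_of_pos_right _ (s.H_pos n)
    _ = s.H (n + 1) := by rw [s.H_succ]; ring
    _ ≤ _ := s.H_le_Q _

lemma isCoprime (n : ℕ) : IsCoprime (s.P n) (s.Q n : ℤ) :=
  ⟨-s.Q (n + 1), s.P (n + 1), by linear_combination s.det n⟩

lemma two_pow_le_Q (n : ℕ) : 2 ^ n ≤ s.Q n := by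
  induction n with
  | zero => exact s.Q_pos 0
  | succ n _ =>
    calc 2 ^ (n + 1) ≤ 8 ^ (n + 1) := Nat.pow_le_pow_left (by norm_num) _
      _ ≤ 8 ^ (n + 4) := Nat.pow_le_pow_right (by norm_num) (by omega)
      _ ≤ 8 ^ (n + 4) * s.Q n ^ 3 :=
        Nat.le_mul_of_pos_right _ (by have := s.Q_pos n; positivity)
      _ ≤ _ := s.Q_growth n

lemma tendsto_Q : Tendsto s.Q atTop atTop :=
  tendsto_atTop_mono s.two_pow_le_Q (tendsto_pow_atTop_atTop_of_one_lt one_lt_two)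

lemma irrational (s : Scheme θ) : Irrational θ := by
  rintro ⟨r, rfl⟩
  obtain ⟨n, hn⟩ := eventually_atTop.1 (s.tendsto_Q.eventually_gt_atTop (2 * r.den))
  have h1 := s.err_pos n
  have h2 := s.err_le n
  have h3 := hn (n + 1) (by omega)
  have hden : (0 : ℝ) < r.den := by exact_mod_cast r.den_pos
  have hr : (r : ℝ) * r.den = r.num := by exact_mod_cast Rat.mul_den_eq_num r
  have h4 : (s.Q n * (r : ℝ) - s.P n) * r.den = ((s.Q n * r.num - s.P n * r.den : ℤ) : ℝ) := by
    push_cast; linear_combination (s.Q n : ℝ) * hr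
  have h5 : (0 : ℝ) < ((s.Q n * r.num - s.P n * r.den : ℤ) : ℝ) := by rw [← h4]; positivity
  have h6 : (1 : ℝ) ≤ ((s.Q n * r.num - s.P n * r.den : ℤ) : ℝ) := by
    exact_mod_cast (Int.cast_pos.1 h5)
  have h7 : (2 * r.den : ℝ) < s.Q (n + 1) := by exact_mod_cast h3
  rw [← h4] at h6
  nlinarith

end Scheme

lemma mul_add_div_of_lt {a b m : ℕ} (h : b < m) : (a * m + b) / m = a := by
  rw [Nat.mul_comm, Nat.mul_add_div (by omega), Nat.div_eq_of_lt h, add_zero]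

lemma mul_add_mod_of_lt {a b m : ℕ} (h : b < m) : (a * m + b) % m = b := by
  rw [Nat.mul_comm, Nat.mul_add_mod, Nat.mod_eq_of_lt h]

namespace Scheme

variable {θ : ℝ} (s : Scheme θ)

/-- The position in the `n`-th odometer tower of the level `k < H n` of the `n`-th tower of the
rotation. The latter is made of blocks of length `Q n`; among `H n` successive blocks, each block
contributes its first `H n` levels as one copy of the previous odometer tower, and the levels
of a given index `l ≥ H n` form together another copy. -/
def toOdo : ℕ → ℕ → ℕ
  | 0, k => k
  | n + 1, k =>
    if k % s.Q n < s.H n then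
      (k / s.Q n / s.H n * s.Q n + k / s.Q n % s.H n) * s.H n + toOdo n (k % s.Q n)
    else
      (k / s.Q n / s.H n * s.Q n + k % s.Q n) * s.H n + k / s.Q n % s.H n

/-- The inverse of `toOdo`. -/
def ofOdo : ℕ → ℕ → ℕ
  | 0, k => k
  | n + 1, k =>
    if k / s.H n % s.Q n < s.H n then
      (k / s.H n / s.Q n * s.H n + k / s.H n % s.Q n) * s.Q n + ofOdo n (k % s.H n)
    else
      (k / s.H n / s.Q n * s.H n + k % s.H n) * s.Q n + k / s.H n % s.Q n

lemma toOdo_succ_of_lt {n l : ℕ} (i : ℕ) (hl : l < s.H n) :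
    s.toOdo (n + 1) (i * s.Q n + l) =
      (i / s.H n * s.Q n + i % s.H n) * s.H n + s.toOdo n l := by
  have hlQ := hl.trans_le (s.H_le_Q n)
  rw [toOdo, mul_add_mod_of_lt hlQ, mul_add_div_of_lt hlQ, if_pos hl]

lemma toOdo_succ_of_ge {n l c b : ℕ} (hb : b < s.H n) (hlQ : l < s.Q n) (hl : s.H n ≤ l) :
    s.toOdo (n + 1) ((c * s.H n + b) * s.Q n + l) = (c * s.Q n + l) * s.H n + b := by
  rw [toOdo, mul_add_mod_of_lt hlQ, mul_add_div_of_lt hlQ, if_neg hl.not_gt,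
    mul_add_mod_of_lt hb, mul_add_div_of_lt hb]

lemma ofOdo_succ_of_lt {n c j t : ℕ} (hj : j < s.H n) (ht : t < s.H n) :
    s.ofOdo (n + 1) ((c * s.Q n + j) * s.H n + t) =
      (c * s.H n + j) * s.Q n + s.ofOdo n t := by
  have hjQ := hj.trans_le (s.H_le_Q n)
  rw [ofOdo, mul_add_div_of_lt ht, mul_add_mod_of_lt ht, mul_add_mod_of_lt hjQ,
    mul_add_div_of_lt hjQ, if_pos hj]

lemma ofOdo_succ_of_ge {n c j t : ℕ} (hj : s.H n ≤ j) (hjQ : j < s.Q n) (ht : t < s.H n) :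
    s.ofOdo (n + 1) ((c * s.Q n + j) * s.H n + t) = (c * s.H n + t) * s.Q n + j := by
  rw [ofOdo, mul_add_div_of_lt ht, mul_add_mod_of_lt ht, mul_add_mod_of_lt hjQ,
    mul_add_div_of_lt hjQ, if_neg hj.not_gt]

lemma exists_decomp {a b : ℕ} (ha : 0 < a) (hb : 0 < b) (k : ℕ) :
    ∃ c i l, i < a ∧ l < b ∧ k = (c * a + i) * b + l :=
  ⟨k / b / a, k / b % a, k % b, Nat.mod_lt _ ha, Nat.mod_lt _ hb, by
    rw [Nat.div_add_mod', Nat.div_add_mod']⟩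

lemma decomp_div {a b c i l : ℕ} (hi : i < a) (hl : l < b) :
    ((c * a + i) * b + l) / (a * b) = c := by
  rw [Nat.mul_comm a b, ← Nat.div_div_eq_div_mul, mul_add_div_of_lt hl, mul_add_div_of_lt hi]

lemma toOdo_lt_and_ofOdo_toOdo (n : ℕ) :
    ∀ k, (k < s.H n → s.toOdo n k < s.H n ∧ s.ofOdo n (s.toOdo n k) = k) ∧
      (k < s.H n → s.ofOdo n k < s.H n ∧ s.toOdo n (s.ofOdo n k) = k) := by
  induction n with
  | zero => simp [toOdo, ofOdo]
  | succ n ih =>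
    have hH := s.H_pos n
    have hQ := s.Q_pos n
    have hHQ := s.H_le_Q n
    have key : ∀ m, m < s.H (n + 1) ↔ m / (s.H n * s.Q n) < s.K n := fun m => by
      rw [s.H_succ, Nat.div_lt_iff_lt_mul (by positivity), mul_assoc]
    intro k
    constructor
    · intro hk
      obtain ⟨c, b, l, hb, hl, rfl⟩ := exists_decomp hH hQ k
      rw [key, decomp_div hb hl] at hk
      by_cases h : l < s.H n
      · obtain ⟨h1, h2⟩ := (ih l).1 h
        rw [toOdo_succ_of_lt _ _ h, mul_add_div_of_lt hb, mul_add_mod_of_lt hb,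
          ofOdo_succ_of_lt _ hb h1, h2, key, mul_comm (s.H n), decomp_div (hb.trans_le hHQ) h1]
        exact ⟨hk, rfl⟩
      · rw [toOdo_succ_of_ge _ hb hl (not_lt.1 h), ofOdo_succ_of_ge _ (not_lt.1 h) hl hb, key,
          mul_comm (s.H n), decomp_div hl hb]
        exact ⟨hk, rfl⟩
    · intro hk
      obtain ⟨c, j, t, hj, ht, rfl⟩ := exists_decomp hQ hH k
      rw [key, mul_comm (s.H n), decomp_div hj ht] at hk
      by_cases h : j < s.H n
      · obtain ⟨h1, h2⟩ := (ih t).2 ht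
        rw [ofOdo_succ_of_lt _ h ht, toOdo_succ_of_lt _ _ h1, mul_add_div_of_lt h,
          mul_add_mod_of_lt h, h2, key, decomp_div h (h1.trans_le hHQ)]
        exact ⟨hk, rfl⟩
      · rw [ofOdo_succ_of_ge _ (not_lt.1 h) hj ht, toOdo_succ_of_ge _ ht hj (not_lt.1 h), key,
          decomp_div ht hj]
        exact ⟨hk, rfl⟩

lemma toOdo_lt {n k : ℕ} (hk : k < s.H n) : s.toOdo n k < s.H n :=
  ((s.toOdo_lt_and_ofOdo_toOdo n k).1 hk).1

lemma ofOdo_lt {n k : ℕ} (hk : k < s.H n) : s.ofOdo n k < s.H n :=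
  ((s.toOdo_lt_and_ofOdo_toOdo n k).2 hk).1

lemma ofOdo_toOdo {n k : ℕ} (hk : k < s.H n) : s.ofOdo n (s.toOdo n k) = k :=
  ((s.toOdo_lt_and_ofOdo_toOdo n k).1 hk).2

lemma toOdo_ofOdo {n k : ℕ} (hk : k < s.H n) : s.toOdo n (s.ofOdo n k) = k :=
  ((s.toOdo_lt_and_ofOdo_toOdo n k).2 hk).2

lemma toOdo_succ_div (n k : ℕ) :
    s.toOdo (n + 1) k / (s.H n * s.Q n) = k / (s.H n * s.Q n) := by
  obtain ⟨c, b, l, hb, hl, rfl⟩ := exists_decomp (s.H_pos n) (s.Q_pos n) k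
  rw [decomp_div hb hl]
  by_cases h : l < s.H n
  · rw [toOdo_succ_of_lt _ _ h, mul_add_div_of_lt hb, mul_add_mod_of_lt hb, mul_comm (s.H n),
      decomp_div (hb.trans_le (s.H_le_Q n)) (s.toOdo_lt h)]
  · rw [toOdo_succ_of_ge _ hb hl (not_lt.1 h), mul_comm (s.H n), decomp_div hl hb]

lemma abs_sub_le_of_div_eq {a b c d m : ℕ} (hm : 0 < m) (hca : c / m = a / m)
    (hdb : d / m = b / m) (hab : b = a + 1) : |(d : ℤ) - c| ≤ 2 * m := by
  have h1 := Nat.div_add_mod c m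
  have h2 := Nat.div_add_mod d m
  have h3 := Nat.mod_lt c hm
  have h4 := Nat.mod_lt d hm
  have h5 : a / m ≤ b / m := Nat.div_le_div_right (by omega)
  have h6 : b / m ≤ a / m + 1 := by
    rw [← Nat.add_div_right _ hm]
    exact Nat.div_le_div_right (by omega)
  rw [hca] at h1
  rw [hdb] at h2
  have h7 : m * (b / m) ≤ m * (a / m) + m := by
    calc m * (b / m) ≤ m * (a / m + 1) := by gcongr
      _ = _ := by ring
  have h8 : m * (a / m) ≤ m * (b / m) := by gcongr
  rw [abs_le]
  omega

lemma abs_toOdo_sub_le (n k : ℕ) :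
    |(s.toOdo (n + 1) (k + 1) : ℤ) - s.toOdo (n + 1) k| ≤ 2 * s.Q n ^ 2 := by
  refine (abs_sub_le_of_div_eq (Nat.mul_pos (s.H_pos n) (s.Q_pos n)) (s.toOdo_succ_div n k)
    (s.toOdo_succ_div n (k + 1)) rfl).trans ?_
  have := Nat.mul_le_mul_right (s.Q n) (s.H_le_Q n)
  zify at this
  push_cast
  linarith

lemma abs_ofOdo_sub_le {n k : ℕ} (hk : k + 1 < s.H (n + 1)) :
    |(s.ofOdo (n + 1) (k + 1) : ℤ) - s.ofOdo (n + 1) k| ≤ 2 * s.Q n ^ 2 := by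
  have h : ∀ j < s.H (n + 1),
      s.ofOdo (n + 1) j / (s.H n * s.Q n) = j / (s.H n * s.Q n) := fun j hj => by
    rw [← s.toOdo_succ_div n (s.ofOdo (n + 1) j), s.toOdo_ofOdo hj]
  refine (abs_sub_le_of_div_eq (Nat.mul_pos (s.H_pos n) (s.Q_pos n)) (h k (by omega))
    (h (k + 1) hk) rfl).trans ?_
  have := Nat.mul_le_mul_right (s.Q n) (s.H_le_Q n)
  zify at this
  push_cast
  linarith

end Scheme

namespace Scheme

variable {θ : ℝ} (s : Scheme θ)

/-- The displacement of the rotation by `θ` after `Q n` steps. -/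
noncomputable def err (n : ℕ) : ℝ := s.Q n * θ - s.P n

/-- The width of the `n`-th Rokhlin tower of the rotation. -/
noncomputable def width (n : ℕ) : ℝ := 1 / s.Q n - s.err n

/-- The base of the `n`-th Rokhlin tower of the rotation. -/
def base (n : ℕ) : Set (AddCircle (1 : ℝ)) :=
  (fun t : ℝ => (t : AddCircle (1 : ℝ))) '' Ioc 0 (s.width n)

/-- The levels of the `n`-th Rokhlin tower of the rotation. -/
def level (n k : ℕ) : Set (AddCircle (1 : ℝ)) := {x | x - k • (θ : AddCircle (1 : ℝ)) ∈ s.base n}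

lemma Q_posR (n : ℕ) : (0 : ℝ) < s.Q n := by exact_mod_cast s.Q_pos n

lemma err_posR (n : ℕ) : 0 < s.err n := s.err_pos n

lemma width_le (n : ℕ) : s.width n ≤ 1 / s.Q n := by
  have := s.err_posR n
  rw [width]; linarith

lemma width_le_one (n : ℕ) : s.width n ≤ 1 := by
  refine (s.width_le n).trans ?_
  rw [div_le_one (s.Q_posR n)]
  exact_mod_cast s.Q_pos n

lemma measurableSet_base (n : ℕ) : MeasurableSet (s.base n) := by
  refine measurableSet_Ioc.image_of_continuousOn_injOn
    (AddCircle.continuous_mk' 1).continuousOn ?_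
  intro a ha b hb hab
  have := s.width_le_one n
  refine (AddCircle.coe_eq_coe_iff_of_mem_Ioc (p := (1 : ℝ)) (a := 0) ?_ ?_).1 hab
  · exact ⟨ha.1, by linarith [ha.2]⟩
  · exact ⟨hb.1, by linarith [hb.2]⟩

lemma volume_base (n : ℕ) : volume (s.base n) = ENNReal.ofReal (s.width n) := by
  have h := (AddCircle.measurePreserving_mk 1 0).measure_preimage
    (s.measurableSet_base n).nullMeasurableSet
  have hw := s.width_le_one n
  rw [← h, Measure.restrict_apply ((AddCircle.measurePreserving_mk 1 0).measurable
    (s.measurableSet_base n))]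
  have : (QuotientAddGroup.mk ⁻¹' s.base n : Set ℝ) ∩ Ioc 0 (0 + 1) = Ioc 0 (s.width n) := by
    ext t
    constructor
    · rintro ⟨⟨u, hu, hut⟩, ht⟩
      have : u = t := (AddCircle.coe_eq_coe_iff_of_mem_Ioc (p := (1 : ℝ)) (a := 0)
        ⟨hu.1, by linarith [hu.2]⟩ ht).1 hut
      exact this ▸ hu
    · intro ht
      exact ⟨⟨t, ht, rfl⟩, ht.1, by linarith [ht.2]⟩
  rw [this, Real.volume_Ioc, sub_zero]

lemma level_eq_preimage (n k : ℕ) :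
    s.level n k = (fun x => x + -(k • (θ : AddCircle (1 : ℝ)))) ⁻¹' s.base n := by
  ext x; simp [level, sub_eq_add_neg]

lemma measurableSet_level (n k : ℕ) : MeasurableSet (s.level n k) := by
  rw [level_eq_preimage]
  exact measurable_add_const _ (s.measurableSet_base n)

lemma volume_level (n k : ℕ) : volume (s.level n k) = ENNReal.ofReal (s.width n) := by
  rw [level_eq_preimage, measure_preimage_add_right, volume_base]

lemma add_mem_level {n k l : ℕ} {d : ℤ} {x : AddCircle (1 : ℝ)} (hx : x ∈ s.level n k)
    (hd : (l : ℤ) = k + d) : x + d • (θ : AddCircle (1 : ℝ)) ∈ s.level n l := by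
  have : x + d • (θ : AddCircle (1 : ℝ)) - l • (θ : AddCircle (1 : ℝ)) =
      x - k • (θ : AddCircle (1 : ℝ)) := by
    rw [← natCast_zsmul, ← natCast_zsmul, hd, add_zsmul]; abel
  rw [level, mem_ofPred_eq, this]
  exact hx

lemma mem_level_iff {n k : ℕ} {x : AddCircle (1 : ℝ)} :
    x ∈ s.level n k ↔ ∃ t ∈ Ioc 0 (s.width n), x = ((t + k * θ : ℝ) : AddCircle (1 : ℝ)) := by
  simp only [level, base, mem_ofPred_eq, mem_image, eq_sub_iff_add_eq, AddCircle.coe_add]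
  simp only [← nsmul_eq_mul, AddCircle.coe_nsmul, eq_comm]

lemma level_unique {n k l : ℕ} {x : AddCircle (1 : ℝ)} (hk : k < s.Q n) (hl : l < s.Q n)
    (hxk : x ∈ s.level n k) (hxl : x ∈ s.level n l) : k = l := by
  rw [mem_level_iff] at hxk hxl
  obtain ⟨t, ht, rfl⟩ := hxk
  obtain ⟨u, hu, hxu⟩ := hxl
  rw [← sub_eq_zero, ← AddCircle.coe_sub, AddCircle.coe_eq_zero_iff] at hxu
  obtain ⟨N, hN⟩ := hxu
  rw [zsmul_eq_mul, mul_one] at hN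
  have hQ := s.Q_posR n
  have he := s.err_posR n
  have hkR : (k : ℝ) + 1 ≤ s.Q n := by exact_mod_cast hk
  have hlR : (l : ℝ) + 1 ≤ s.Q n := by exact_mod_cast hl
  have hwQ : s.Q n * s.width n = 1 - s.Q n * s.err n := by
    rw [width]; field_simp
  set m : ℤ := s.Q n * N - (k - l) * s.P n with hm
  have hmR : (m : ℝ) = s.Q n * (t - u) + (k - l) * s.err n := by
    rw [hm, err]; push_cast; rw [hN]; ring
  have hm0 : m = 0 := by
    rw [← Int.abs_lt_one_iff]
    have : |(m : ℝ)| < 1 := by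
      rw [hmR, abs_lt]
      have e1 : s.Q n * t ≤ s.Q n * s.width n := by gcongr; exact ht.2
      have e2 : s.Q n * u ≤ s.Q n * s.width n := by gcongr; exact hu.2
      have e3 : 0 < s.Q n * t := mul_pos hQ ht.1
      have e4 : 0 < s.Q n * u := mul_pos hQ hu.1
      have e5 : (k - l) * s.err n ≤ s.Q n * s.err n := by
        gcongr; linarith [Nat.cast_nonneg (α := ℝ) l]
      have e6 : (l - k) * s.err n ≤ s.Q n * s.err n := by
        gcongr; linarith [Nat.cast_nonneg (α := ℝ) k]
      constructor <;> linarith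
    exact_mod_cast this
  have hdvd : (s.Q n : ℤ) ∣ k - l :=
    (s.isCoprime n).symm.dvd_of_dvd_mul_right ⟨N, by linarith⟩
  have := Int.eq_zero_of_abs_lt_dvd hdvd (by rw [abs_lt]; omega)
  omega

lemma level_of_level_succ {n i l : ℕ} {x : AddCircle (1 : ℝ)} (hi : i < s.K n * s.H n)
    (hx : x ∈ s.level (n + 1) (i * s.Q n + l)) : x ∈ s.level n l := by
  rw [mem_level_iff] at hx ⊢
  obtain ⟨t, ht, rfl⟩ := hx
  have hQ := s.Q_posR n
  have hQ' := s.Q_posR (n + 1)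
  have he := s.err_posR n
  have he' := s.err_posR (n + 1)
  have hrel : s.Q (n + 1) * s.err n = 1 + s.Q n * s.err (n + 1) := by
    have : (s.P (n + 1) * s.Q n - s.P n * s.Q (n + 1) : ℝ) = 1 := by exact_mod_cast s.det n
    rw [err, err]; linear_combination this
  have hQs : (s.Q (n + 1) : ℝ) = s.K n * s.H n * s.Q n + s.v (n + 1) := by
    rw [s.Q_eq, s.H_succ]; push_cast; ring
  have hv : (s.Q n : ℝ) ≤ s.v (n + 1) := by exact_mod_cast s.v_ge n
  have hi' : (i : ℝ) + 1 ≤ s.K n * s.H n := by exact_mod_cast hi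
  refine ⟨t + i * s.err n, ⟨by have := ht.1; positivity, ?_⟩, ?_⟩
  · have h1 := ht.2
    have h2 : (i + 1 : ℝ) * s.err n ≤ s.K n * s.H n * s.err n := by gcongr
    suffices s.K n * s.H n * s.err n + 1 / s.Q (n + 1) ≤ 1 / s.Q n + s.err (n + 1) by
      simp only [width] at *
      linarith
    rw [← sub_nonneg]
    have h3 : 0 ≤ ((s.v (n + 1) - s.Q n) / s.Q n + s.v (n + 1) * s.err (n + 1)) / s.Q (n + 1) := by
      have : 0 ≤ (s.v (n + 1) - s.Q n : ℝ) := by linarith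
      positivity
    have h4 : s.err n = (1 + s.Q n * s.err (n + 1)) / s.Q (n + 1) := by
      rw [← hrel]; field_simp
    convert h3 using 1
    rw [h4]
    field_simp
    rw [hQs]
    ring
  · have : t + ((i * s.Q n + l : ℕ) : ℝ) * θ = t + i * s.err n + l * θ + (i * s.P n : ℤ) := by
      rw [err]; push_cast; ring
    rw [this, AddCircle.coe_add (1 : ℝ) _ (((i * s.P n : ℤ)) : ℝ),
      (AddCircle.coe_eq_zero_iff (1 : ℝ) (x := ((i * s.P n : ℤ) : ℝ))).2
        ⟨i * s.P n, by rw [zsmul_eq_mul, mul_one]⟩, add_zero]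

lemma norm_sub_le_of_mem_level {n k : ℕ} {x y : AddCircle (1 : ℝ)} (hx : x ∈ s.level n k)
    (hy : y ∈ s.level n k) : ‖x - y‖ ≤ 1 / s.Q n := by
  rw [mem_level_iff] at hx hy
  obtain ⟨t, ht, rfl⟩ := hx
  obtain ⟨u, hu, rfl⟩ := hy
  have hw := s.width_le n
  rw [← AddCircle.coe_sub]
  refine QuotientAddGroup.norm_mk_le_norm.trans ?_
  rw [Real.norm_eq_abs, abs_le]
  constructor <;> linarith [ht.1, ht.2, hu.1, hu.2]

lemma eq_of_frequently_mem_level {x y : AddCircle (1 : ℝ)}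
    (h : ∃ᶠ n in atTop, ∃ k, x ∈ s.level n k ∧ y ∈ s.level n k) : x = y := by
  rw [← sub_eq_zero, ← norm_le_zero_iff]
  have hlim : Tendsto (fun n => 1 / (s.Q n : ℝ)) atTop (𝓝 0) :=
    tendsto_const_nhds.div_atTop (tendsto_natCast_atTop_atTop.comp s.tendsto_Q)
  refine ge_of_tendsto_of_frequently hlim (h.mono ?_)
  rintro n ⟨k, hx, hy⟩
  exact s.norm_sub_le_of_mem_level hx hy

end Scheme

namespace Scheme

variable {θ : ℝ} (s : Scheme θ)

/-- The part of the `n`-th Rokhlin tower which carries the `n`-th odometer tower. -/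
def tower (n : ℕ) : Set (AddCircle (1 : ℝ)) := {x | ∃ k < s.H n, x ∈ s.level n k}

/-- The index of the level of `tower n` containing a point (zero outside of `tower n`). -/
noncomputable def pos (n : ℕ) (x : AddCircle (1 : ℝ)) : ℕ :=
  ∑ k ∈ Finset.range (s.H n), (s.level n k).indicator (fun _ => k) x

/-- The position of a point in the `n`-th odometer tower. -/
noncomputable def odo (n : ℕ) (x : AddCircle (1 : ℝ)) : ℕ := s.toOdo n (s.pos n x)

variable {s} {n : ℕ} {x y : AddCircle (1 : ℝ)}

lemma pos_eq {k : ℕ} (hk : k < s.H n) (hx : x ∈ s.level n k) : s.pos n x = k := by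
  rw [pos, Finset.sum_eq_single k]
  · simp [hx]
  · intro l hl hlk
    refine indicator_of_notMem (fun hxl => hlk ?_) _
    have hHQ := s.H_le_Q n
    have := Finset.mem_range.1 hl
    exact s.level_unique (by omega) (by omega) hxl hx
  · intro h
    exact absurd (Finset.mem_range.2 hk) h

lemma pos_lt (hx : x ∈ s.tower n) : s.pos n x < s.H n := by
  obtain ⟨k, hk, hxk⟩ := hx
  rwa [pos_eq hk hxk]

lemma mem_level_pos (hx : x ∈ s.tower n) : x ∈ s.level n (s.pos n x) := by
  obtain ⟨k, hk, hxk⟩ := hx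
  rwa [pos_eq hk hxk]

lemma odo_lt (hx : x ∈ s.tower n) : s.odo n x < s.H n := s.toOdo_lt (pos_lt hx)

lemma ofOdo_odo (hx : x ∈ s.tower n) : s.ofOdo n (s.odo n x) = s.pos n x :=
  s.ofOdo_toOdo (pos_lt hx)

lemma odo_eq {j : ℕ} (hj : j < s.H n) (hx : x ∈ s.level n (s.ofOdo n j)) : s.odo n x = j := by
  rw [odo, pos_eq (s.ofOdo_lt hj) hx, s.toOdo_ofOdo hj]

lemma mem_tower_of_mem_level {k : ℕ} (hk : k < s.H n) (hx : x ∈ s.level n k) : x ∈ s.tower n :=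
  ⟨k, hk, hx⟩

lemma measurableSet_tower (n : ℕ) : MeasurableSet (s.tower n) := by
  have : s.tower n = ⋃ k ∈ Finset.range (s.H n), s.level n k := by ext; simp [tower]
  rw [this]
  exact Finset.measurableSet_biUnion _ fun k _ => s.measurableSet_level n k

lemma measurable_pos (n : ℕ) : Measurable (s.pos n) :=
  Finset.measurable_fun_sum _ fun k _ => measurable_const.indicator (s.measurableSet_level n k)

lemma measurable_odo (n : ℕ) : Measurable (s.odo n) :=
  (measurable_of_countable (s.toOdo n)).comp (measurable_pos n)

/-- A point in two successive towers sees the first one as a block of the second one, both from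
the point of view of the rotation and from that of the odometer. -/
lemma exists_block (hx : x ∈ s.tower n) (hx' : x ∈ s.tower (n + 1)) : ∃ i f : ℕ,
    s.pos (n + 1) x = i * s.Q n + s.pos n x ∧ ∀ l < s.H n, i * s.Q n + l < s.H (n + 1) ∧
      s.toOdo (n + 1) (i * s.Q n + l) = f * s.H n + s.toOdo n l := by
  have hQ := s.Q_pos n
  have hHQ := s.H_le_Q n
  have h1 := pos_lt hx'
  have h2 := mem_level_pos hx'
  set k := s.pos (n + 1) x
  have hi : k / s.Q n < s.K n * s.H n := by
    rwa [Nat.div_lt_iff_lt_mul hQ, ← s.H_succ]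
  have hk : k = k / s.Q n * s.Q n + k % s.Q n := (Nat.div_add_mod' _ _).symm
  rw [hk] at h2
  have h3 := s.level_of_level_succ hi h2
  have h4 : k % s.Q n = s.pos n x :=
    s.level_unique (Nat.mod_lt _ hQ) ((pos_lt hx).trans_le hHQ) h3 (mem_level_pos hx)
  refine ⟨k / s.Q n, _, by rw [← h4]; exact hk, fun l hl => ⟨?_, s.toOdo_succ_of_lt _ hl⟩⟩
  calc k / s.Q n * s.Q n + l < (k / s.Q n + 1) * s.Q n := by rw [add_one_mul]; omega
    _ ≤ s.K n * s.H n * s.Q n := by gcongr; omega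
    _ = _ := (s.H_succ n).symm

lemma odo_succ_mod (hx : x ∈ s.tower n) (hx' : x ∈ s.tower (n + 1)) :
    s.odo (n + 1) x % s.H n = s.odo n x := by
  obtain ⟨i, f, h1, h2⟩ := exists_block hx hx'
  rw [odo, h1, (h2 _ (pos_lt hx)).2, mul_add_mod_of_lt (s.toOdo_lt (pos_lt hx))]
  rfl

variable (s) in
/-- The displacement, in terms of the rotation, induced by moving by `d` in the `n`-th odometer
tower (zero if this leads out of the tower). -/
noncomputable def disp (n : ℕ) (d : ℤ) (x : AddCircle (1 : ℝ)) : ℤ :=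
  if 0 ≤ s.odo n x + d ∧ s.odo n x + d < s.H n then
    (s.ofOdo n (s.odo n x + d).toNat : ℤ) - s.ofOdo n (s.odo n x) else 0

variable (s) in
/-- The displacement in the `n`-th odometer tower induced by the rotation (zero on the top
level). -/
noncomputable def rotDisp (n : ℕ) (x : AddCircle (1 : ℝ)) : ℤ :=
  if s.pos n x + 1 < s.H n then
    (s.toOdo n (s.pos n x + 1) : ℤ) - s.toOdo n (s.pos n x) else 0

lemma measurable_disp (n : ℕ) (d : ℤ) : Measurable (s.disp n d) :=
  (measurable_of_countable fun j : ℕ => if 0 ≤ (j : ℤ) + d ∧ (j : ℤ) + d < s.H n then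
    (s.ofOdo n ((j : ℤ) + d).toNat : ℤ) - s.ofOdo n j else 0).comp (measurable_odo n)

lemma measurable_rotDisp (n : ℕ) : Measurable (s.rotDisp n) :=
  (measurable_of_countable fun j : ℕ => if j + 1 < s.H n then
    (s.toOdo n (j + 1) : ℤ) - s.toOdo n j else 0).comp (measurable_pos n)

lemma disp_succ {d : ℤ} (hx : x ∈ s.tower n) (hx' : x ∈ s.tower (n + 1))
    (h0 : 0 ≤ s.odo n x + d) (h1 : s.odo n x + d < s.H n) :
    (0 ≤ s.odo (n + 1) x + d ∧ s.odo (n + 1) x + d < s.H (n + 1)) ∧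
      s.disp (n + 1) d x = s.disp n d x := by
  obtain ⟨i, f, hi, hf⟩ := exists_block hx hx'
  obtain ⟨j, hj⟩ := Int.eq_ofNat_of_zero_le h0
  have hjH : j < s.H n := by omega
  have hodo : s.odo (n + 1) x = f * s.H n + s.odo n x := by
    rw [odo, hi, (hf _ (pos_lt hx)).2]; rfl
  obtain ⟨h2, h3⟩ := hf _ (s.ofOdo_lt hjH)
  rw [s.toOdo_ofOdo hjH] at h3
  have h4 : s.odo (n + 1) x + d = (f * s.H n + j : ℕ) := by
    rw [hodo]; push_cast; linarith
  have h5 : f * s.H n + j < s.H (n + 1) := h3 ▸ s.toOdo_lt h2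
  have h6 : s.ofOdo (n + 1) (f * s.H n + j) = i * s.Q n + s.ofOdo n j := by
    rw [← h3, s.ofOdo_toOdo h2]
  have hb : 0 ≤ s.odo (n + 1) x + d ∧ s.odo (n + 1) x + d < s.H (n + 1) := by
    rw [h4]; exact ⟨by positivity, by exact_mod_cast h5⟩
  refine ⟨hb, ?_⟩
  rw [disp, disp, if_pos hb, if_pos ⟨h0, h1⟩, ofOdo_odo hx, ofOdo_odo hx', h4, hj, hi,
    Int.toNat_natCast, h6]
  simp

lemma rotDisp_succ (hx : x ∈ s.tower n) (hx' : x ∈ s.tower (n + 1))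
    (h : s.pos n x + 1 < s.H n) : s.pos (n + 1) x + 1 < s.H (n + 1) ∧
      s.rotDisp (n + 1) x = s.rotDisp n x := by
  obtain ⟨i, f, hi, hf⟩ := exists_block hx hx'
  obtain ⟨h1, h2⟩ := hf _ h
  obtain ⟨h3, h4⟩ := hf _ (pos_lt hx)
  have hb : s.pos (n + 1) x + 1 < s.H (n + 1) := by rw [hi]; omega
  refine ⟨hb, ?_⟩
  rw [rotDisp, rotDisp, if_pos hb, if_pos h, hi, add_assoc, h2, h4]
  simp

lemma disp_eq_of_le {d : ℤ} {m : ℕ} (hx : ∀ m, n ≤ m → x ∈ s.tower m)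
    (h0 : 0 ≤ s.odo n x + d) (h1 : s.odo n x + d < s.H n) (hm : n ≤ m) :
    (0 ≤ s.odo m x + d ∧ s.odo m x + d < s.H m) ∧ s.disp m d x = s.disp n d x := by
  induction m, hm using Nat.le_induction with
  | base => exact ⟨⟨h0, h1⟩, rfl⟩
  | succ m hm ih =>
    have := disp_succ (hx m hm) (hx (m + 1) (by omega)) ih.1.1 ih.1.2
    exact ⟨this.1, this.2.trans ih.2⟩

lemma rotDisp_eq_of_le {m : ℕ} (hx : ∀ m, n ≤ m → x ∈ s.tower m)
    (h : s.pos n x + 1 < s.H n) (hm : n ≤ m) :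
    s.pos m x + 1 < s.H m ∧ s.rotDisp m x = s.rotDisp n x := by
  induction m, hm using Nat.le_induction with
  | base => exact ⟨h, rfl⟩
  | succ m hm ih =>
    have := rotDisp_succ (hx m hm) (hx (m + 1) (by omega)) ih.1
    exact ⟨this.1, this.2.trans ih.2⟩

lemma H_dvd {m : ℕ} (s : Scheme θ) (hm : n ≤ m) : s.H n ∣ s.H m := by
  induction m, hm using Nat.le_induction with
  | base => exact dvd_rfl
  | succ m _ ih => exact ih.trans ⟨s.K m * s.Q m, by rw [s.H_succ]; ring⟩

lemma odo_mod_of_le {m : ℕ} (hx : ∀ m, n ≤ m → x ∈ s.tower m) (hm : n ≤ m) :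
    s.odo m x % s.H n = s.odo n x := by
  induction m, hm using Nat.le_induction with
  | base => exact Nat.mod_eq_of_lt (odo_lt (hx n le_rfl))
  | succ m hm ih =>
    rw [← ih, ← odo_succ_mod (hx m hm) (hx (m + 1) (by omega)), Nat.mod_mod_of_dvd _ (s.H_dvd hm)]

lemma add_disp_mem_tower {d : ℤ} (hx : x ∈ s.tower n) (h0 : 0 ≤ s.odo n x + d)
    (h1 : s.odo n x + d < s.H n) :
    x + s.disp n d x • (θ : AddCircle (1 : ℝ)) ∈ s.tower n ∧
      (s.odo n (x + s.disp n d x • (θ : AddCircle (1 : ℝ))) : ℤ) = s.odo n x + d := by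
  obtain ⟨j, hj⟩ := Int.eq_ofNat_of_zero_le h0
  have hjH : j < s.H n := by omega
  have : x + s.disp n d x • (θ : AddCircle (1 : ℝ)) ∈ s.level n (s.ofOdo n j) := by
    refine s.add_mem_level (mem_level_pos hx) ?_
    rw [disp, if_pos ⟨h0, h1⟩, ofOdo_odo hx, hj, Int.toNat_natCast]
    ring
  exact ⟨mem_tower_of_mem_level (s.ofOdo_lt hjH) this, by rw [odo_eq hjH this, hj]⟩

lemma eq_of_odo_eq (hx : ∀ᶠ m in atTop, x ∈ s.tower m) (hy : ∀ᶠ m in atTop, y ∈ s.tower m)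
    (h : ∃ᶠ m in atTop, s.odo m x = s.odo m y) : x = y := by
  refine s.eq_of_frequently_mem_level ((h.and_eventually (hx.and hy)).mono ?_)
  rintro m ⟨h1, h2, h3⟩
  have : s.pos m x = s.pos m y := by rw [← ofOdo_odo h2, ← ofOdo_odo h3, h1]
  exact ⟨s.pos m x, mem_level_pos h2, this ▸ mem_level_pos h3⟩

variable (s) in
/-- The set of points having a well defined two-sided orbit under the odometer. -/
def core : Set (AddCircle (1 : ℝ)) :=
  {x | ∀ L : ℕ, ∀ᶠ m in atTop, x ∈ s.tower m ∧ L ≤ s.odo m x ∧ s.odo m x + L < s.H m}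

lemma measurableSet_eventually {α : Type*} [MeasurableSpace α] {p : ℕ → α → Prop}
    (hp : ∀ n, MeasurableSet {x | p n x}) : MeasurableSet {x | ∀ᶠ n in atTop, p n x} := by
  have : {x | ∀ᶠ n in atTop, p n x} = ⋃ N, ⋂ n, ⋂ (_ : N ≤ n), {x | p n x} := by
    ext x; simp [eventually_atTop]
  rw [this]
  exact .iUnion fun N => .iInter fun n => .iInter fun _ => hp n

lemma measurableSet_core : MeasurableSet s.core := by
  have : s.core = ⋂ L : ℕ, {x | ∀ᶠ m in atTop, x ∈ s.tower m ∧ L ≤ s.odo m x ∧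
      s.odo m x + L < s.H m} := by ext; simp [core]
  rw [this]
  refine .iInter fun L => measurableSet_eventually fun m => (measurableSet_tower m).inter ?_
  exact measurable_odo m (MeasurableSet.of_discrete (s := {j | L ≤ j ∧ j + L < s.H m}))

lemma eventually_of_mem_core (hx : x ∈ s.core) (d : ℤ) : ∀ᶠ m in atTop,
    x ∈ s.tower m ∧ 0 ≤ s.odo m x + d ∧ s.odo m x + d < s.H m := by
  filter_upwards [hx d.natAbs] with m hm
  exact ⟨hm.1, by omega, by omega⟩

lemma eventually_mem_tower (hx : x ∈ s.core) : ∀ᶠ m in atTop, x ∈ s.tower m :=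
  (hx 0).mono fun _ h => h.1

lemma exists_eventually_disp_eq (hx : x ∈ s.core) (d : ℤ) :
    ∃ c, ∀ᶠ m in atTop, s.disp m d x = c := by
  obtain ⟨n, hn⟩ := eventually_atTop.1 (eventually_of_mem_core hx d)
  obtain ⟨-, h0, h1⟩ := hn n le_rfl
  exact ⟨_, eventually_atTop.2 ⟨n, fun m hm =>
    (disp_eq_of_le (fun m hm => (hn m hm).1) h0 h1 hm).2⟩⟩

variable (s) in
open Classical in
/-- The displacement, in terms of the rotation, induced by the `d`-th power of the odometer. -/
noncomputable def cocycle (d : ℤ) (x : AddCircle (1 : ℝ)) : ℤ :=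
  if hx : x ∈ s.core then (exists_eventually_disp_eq hx d).choose else 0

lemma eventually_disp_eq (hx : x ∈ s.core) (d : ℤ) :
    ∀ᶠ m in atTop, s.disp m d x = s.cocycle d x := by
  rw [cocycle, dif_pos hx]
  exact (exists_eventually_disp_eq hx d).choose_spec

lemma measurable_cocycle (d : ℤ) : Measurable (s.cocycle d) := by
  refine measurable_of_tendsto_metrizable (f := fun m => s.core.indicator (s.disp m d))
    (fun m => (measurable_disp m d).indicator measurableSet_core) (tendsto_pi_nhds.2 fun x => ?_)
  by_cases hx : x ∈ s.core
  · refine tendsto_nhds_of_eventually_eq ?_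
    filter_upwards [eventually_disp_eq hx d] with m hm
    rw [indicator_of_mem hx, hm]
  · simp [cocycle, hx]

variable (s) in
/-- The `d`-th power of the odometer. -/
noncomputable def shift (d : ℤ) (x : AddCircle (1 : ℝ)) : AddCircle (1 : ℝ) :=
  x + s.cocycle d x • (θ : AddCircle (1 : ℝ))

lemma measurable_shift (d : ℤ) : Measurable (s.shift d) :=
  measurable_id.add ((measurable_of_countable fun c : ℤ => c • (θ : AddCircle (1 : ℝ))).comp
    (measurable_cocycle d))

lemma shift_of_notMem (hx : x ∉ s.core) (d : ℤ) : s.shift d x = x := by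
  simp [shift, cocycle, hx]

lemma eventually_odo_shift (hx : x ∈ s.core) (d : ℤ) : ∀ᶠ m in atTop,
    s.shift d x ∈ s.tower m ∧ (s.odo m (s.shift d x) : ℤ) = s.odo m x + d := by
  filter_upwards [eventually_of_mem_core hx d, eventually_disp_eq hx d] with m h1 h2
  have := add_disp_mem_tower h1.1 h1.2.1 h1.2.2
  rwa [h2] at this

lemma shift_mem_core (hx : x ∈ s.core) (d : ℤ) : s.shift d x ∈ s.core := by
  intro L
  filter_upwards [eventually_odo_shift hx d, hx (L + d.natAbs)] with m h1 h2
  exact ⟨h1.1, by omega, by omega⟩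

lemma eq_shift {d : ℤ} (hx : x ∈ s.core) (hy : ∀ᶠ m in atTop, y ∈ s.tower m)
    (h : ∃ᶠ m in atTop, (s.odo m y : ℤ) = s.odo m x + d) : y = s.shift d x := by
  refine eq_of_odo_eq hy (eventually_mem_tower (shift_mem_core hx d))
    ((h.and_eventually (eventually_odo_shift hx d)).mono ?_)
  rintro m ⟨h1, h2⟩
  omega

lemma shift_shift (d e : ℤ) (x : AddCircle (1 : ℝ)) :
    s.shift d (s.shift e x) = s.shift (e + d) x := by
  by_cases hx : x ∈ s.core
  · have he := shift_mem_core hx e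
    refine eq_shift hx (eventually_mem_tower (shift_mem_core he d)) (Eventually.frequently ?_)
    filter_upwards [eventually_odo_shift hx e, eventually_odo_shift he d] with m h1 h2
    omega
  · simp only [shift_of_notMem hx]

lemma shift_zero (x : AddCircle (1 : ℝ)) : s.shift 0 x = x := by
  by_cases hx : x ∈ s.core
  · exact (eq_shift hx (eventually_mem_tower hx) (Frequently.of_forall fun m => by simp)).symm
  · exact shift_of_notMem hx 0

variable (s) in
/-- The odometer, acting on the circle with the same orbits as the rotation. -/
noncomputable def odometer : AddCircle (1 : ℝ) ≃ᵐ AddCircle (1 : ℝ) where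
  toFun := s.shift 1
  invFun := s.shift (-1)
  left_inv x := by rw [shift_shift]; exact shift_zero x
  right_inv x := by rw [shift_shift]; exact shift_zero x
  measurable_toFun := measurable_shift 1
  measurable_invFun := measurable_shift (-1)

lemma odometer_iterate (k : ℕ) (x : AddCircle (1 : ℝ)) : (⇑s.odometer)^[k] x = s.shift k x := by
  induction k with
  | zero => simp [shift_zero]
  | succ k ih =>
    rw [Function.iterate_succ_apply', ih]
    exact (shift_shift 1 k x).trans (by push_cast; rfl)

lemma odometer_symm_iterate (k : ℕ) (x : AddCircle (1 : ℝ)) :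
    (⇑s.odometer.symm)^[k] x = s.shift (-k) x := by
  induction k with
  | zero => simp [shift_zero]
  | succ k ih =>
    rw [Function.iterate_succ_apply', ih]
    exact (shift_shift (-1) (-k) x).trans (by congr 1; push_cast; ring)

lemma zIter_odometer (d : ℤ) (x : AddCircle (1 : ℝ)) : zIter s.odometer d x = s.shift d x := by
  rw [zIter]
  split_ifs with h
  · rw [odometer_iterate, Int.toNat_of_nonneg h]
  · rw [odometer_symm_iterate, Int.toNat_of_nonneg (by omega), neg_neg]

end Scheme

instance : IsProbabilityMeasure (volume : Measure (AddCircle (1 : ℝ))) :=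
  ⟨by rw [AddCircle.measure_univ, ENNReal.ofReal_one]⟩

namespace Scheme

variable {θ : ℝ} (s : Scheme θ) {n : ℕ}

/-- The cube root of the denominator `Q n`. -/
noncomputable def root (n : ℕ) : ℝ := (s.Q n : ℝ) ^ ((1 : ℝ) / 3)

lemma root_pow (n : ℕ) : s.root n ^ 3 = s.Q n := by
  rw [root, ← Real.rpow_natCast, ← Real.rpow_mul (Nat.cast_nonneg _)]
  norm_num

lemma one_le_root (n : ℕ) : 1 ≤ s.root n :=
  Real.one_le_rpow (by exact_mod_cast s.Q_pos n) (by norm_num)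

lemma root_pos (n : ℕ) : 0 < s.root n := one_pos.trans_le (s.one_le_root n)

lemma root_growth (n : ℕ) : 2 ^ (n + 4) * s.Q n ≤ s.root (n + 1) := by
  have h : (8 ^ (n + 4) * s.Q n ^ 3 : ℝ) ≤ s.root (n + 1) ^ 3 := by
    rw [s.root_pow]; exact_mod_cast s.Q_growth n
  refine le_of_pow_le_pow_left₀ three_ne_zero (s.root_pos _).le (le_trans (le_of_eq ?_) h)
  rw [mul_pow, ← pow_mul, mul_comm (n + 4), pow_mul]
  norm_num

lemma root_le_succ (n : ℕ) : s.root n ≤ s.root (n + 1) := by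
  refine le_trans ?_ (s.root_growth n)
  have h1 := s.one_le_root n
  have h2 : (1 : ℝ) ≤ 2 ^ (n + 4) := one_le_pow₀ (by norm_num)
  rw [← s.root_pow n]
  calc s.root n ≤ s.root n ^ 3 := le_self_pow₀ h1 three_ne_zero
    _ ≤ _ := le_mul_of_one_le_left (by positivity) h2

lemma monotone_root : Monotone s.root := monotone_nat_of_le_succ s.root_le_succ

/-- A summable sequence controlling the measures of the exceptional sets. -/
noncomputable def small (n : ℕ) : ℝ := (1 / 2) ^ n / s.root n ^ 2

lemma small_pos (n : ℕ) : 0 < s.small n := by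
  have := s.root_pos n
  rw [small]; positivity

lemma small_le (n : ℕ) : s.small n ≤ (1 / 2) ^ n :=
  div_le_self (by positivity) (one_le_pow₀ (s.one_le_root n))

lemma small_add_le (n k : ℕ) : s.small (n + k) ≤ s.small n * (1 / 2) ^ k := by
  have h1 := s.root_pos n
  have h2 := s.monotone_root (Nat.le_add_right n k)
  rw [small, small, pow_add, div_mul_eq_mul_div]
  gcongr

lemma Q_div_le (n : ℕ) : (s.Q n : ℝ) / s.Q (n + 1) ≤ s.small (n + 1) / 8 := by
  have h1 := s.root_pos (n + 1)
  have h2 := s.root_growth n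
  rw [small, ← s.root_pow (n + 1), div_div, div_le_div_iff₀ (by positivity) (by positivity)]
  calc (s.Q n : ℝ) * (s.root (n + 1) ^ 2 * 8)
      = (1 / 2) ^ (n + 1) * (2 ^ (n + 4) * s.Q n) * s.root (n + 1) ^ 2 := by
        rw [one_div, inv_pow, pow_add, pow_add]; field_simp; norm_num
    _ ≤ (1 / 2) ^ (n + 1) * s.root (n + 1) * s.root (n + 1) ^ 2 := by gcongr
    _ = _ := by ring

lemma one_div_Q_le (n : ℕ) : 1 / (s.Q (n + 1) : ℝ) ≤ s.small (n + 1) := by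
  have h1 : (1 : ℝ) ≤ s.Q n := by exact_mod_cast s.Q_pos n
  have h2 := s.Q_posR (n + 1)
  have h3 := s.small_pos (n + 1)
  calc 1 / (s.Q (n + 1) : ℝ) ≤ s.Q n / s.Q (n + 1) := by gcongr
    _ ≤ s.small (n + 1) / 8 := s.Q_div_le n
    _ ≤ _ := by linarith

lemma le_H_mul_width (n : ℕ) : 1 - s.small (n + 1) / 2 ≤ s.H (n + 1) * s.width (n + 1) := by
  have hQ := s.Q_posR (n + 1)
  have hQ' := s.Q_posR (n + 2)
  have he := s.err_posR (n + 1)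
  have h1 : (s.Q (n + 1) : ℝ) = s.H (n + 1) + s.v (n + 1) := by exact_mod_cast s.Q_eq (n + 1)
  have h2 : (s.v (n + 1) : ℝ) / s.Q (n + 1) ≤ 2 * (s.Q n / s.Q (n + 1)) := by
    rw [← mul_div_assoc]; gcongr; exact_mod_cast s.v_le n
  have h3 : s.err (n + 1) * s.H (n + 1) ≤ 2 * (s.Q (n + 1) / s.Q (n + 2)) := by
    rw [← mul_div_assoc, le_div_iff₀ hQ']
    calc s.err (n + 1) * s.H (n + 1) * s.Q (n + 2)
        = s.err (n + 1) * s.Q (n + 2) * s.H (n + 1) := by ring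
      _ ≤ 2 * s.Q (n + 1) := by
        gcongr
        · exact s.err_le (n + 1)
        · exact s.H_le_Q (n + 1)
  have h4 := s.Q_div_le n
  have h5 := s.Q_div_le (n + 1)
  have h6 := s.small_add_le (n + 1) 1
  have h7 : s.H (n + 1) * s.width (n + 1) =
      1 - s.v (n + 1) / s.Q (n + 1) - s.err (n + 1) * s.H (n + 1) := by
    rw [width, eq_sub_of_add_eq h1.symm]; field_simp
  linarith [s.small_pos (n + 1)]

variable {s}

lemma volume_tower (n : ℕ) : volume (s.tower n) = ENNReal.ofReal (s.H n * s.width n) := by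
  have : s.tower n = ⋃ k ∈ Finset.range (s.H n), s.level n k := by ext; simp [tower]
  have hHQ := s.H_le_Q n
  rw [this, measure_biUnion_finset _ fun k _ => s.measurableSet_level n k]
  · simp [volume_level, ENNReal.ofReal_mul]
  · intro k hk l hl hkl
    refine disjoint_left.2 fun x hxk hxl => hkl ?_
    rw [Finset.mem_coe, Finset.mem_range] at hk hl
    exact s.level_unique (by omega) (by omega) hxk hxl

lemma volume_tower_compl_le (n : ℕ) :
    volume (s.tower (n + 1))ᶜ ≤ ENNReal.ofReal (s.small (n + 1) / 2) := by
  rw [prob_compl_eq_one_sub (measurableSet_tower _), volume_tower, tsub_le_iff_right,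
    ← ENNReal.ofReal_one]
  exact (ENNReal.ofReal_le_ofReal (by linarith [s.le_H_mul_width n])).trans ENNReal.ofReal_add_le

lemma volume_level_le (n k : ℕ) :
    volume (s.level (n + 1) k) ≤ ENNReal.ofReal (s.small (n + 1)) := by
  rw [volume_level]
  exact ENNReal.ofReal_le_ofReal ((s.width_le _).trans (s.one_div_Q_le n))

lemma tsum_small (n : ℕ) :
    ∑' k, ENNReal.ofReal (s.small (n + 1 + k) / 2) ≤ ENNReal.ofReal (s.small (n + 1)) := by
  have h := s.small_pos (n + 1)
  calc ∑' k, ENNReal.ofReal (s.small (n + 1 + k) / 2)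
      ≤ ∑' k, ENNReal.ofReal (s.small (n + 1) / 2 * (1 / 2) ^ k) := by
        gcongr with k
        linarith [s.small_add_le (n + 1) k]
    _ = ENNReal.ofReal (∑' k : ℕ, s.small (n + 1) / 2 * (1 / 2) ^ k) :=
        (ENNReal.ofReal_tsum_of_nonneg (fun k => by positivity)
          (summable_geometric_two.mul_left _)).symm
    _ = _ := by rw [tsum_mul_left, tsum_geometric_two]; congr 1; ring

variable (s) in
/-- The points lying in all towers from the `n`-th one on, and outside of a given level of the
`n`-th one. -/
def good (n k : ℕ) : Set (AddCircle (1 : ℝ)) :=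
  {x | (∀ m, n ≤ m → x ∈ s.tower m) ∧ x ∉ s.level n k}

lemma measurableSet_good (n k : ℕ) : MeasurableSet (s.good n k) := by
  have : s.good n k = (⋂ m, ⋂ (_ : n ≤ m), s.tower m) ∩ (s.level n k)ᶜ := by
    ext; simp [good]
  rw [this]
  exact (MeasurableSet.iInter fun m => .iInter fun _ => measurableSet_tower m).inter
    (s.measurableSet_level n k).compl

lemma volume_good_compl_le (n k : ℕ) :
    volume (s.good (n + 1) k)ᶜ ≤ ENNReal.ofReal (2 * s.small (n + 1)) := by
  have h : (s.good (n + 1) k)ᶜ ⊆ (⋃ m, (s.tower (n + 1 + m))ᶜ) ∪ s.level (n + 1) k := by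
    intro x hx
    by_contra hx'
    simp only [mem_union, mem_iUnion, mem_compl_iff, not_or, not_exists, not_not] at hx'
    refine hx ⟨fun m hm => ?_, hx'.2⟩
    obtain ⟨l, rfl⟩ := Nat.exists_eq_add_of_le hm
    exact hx'.1 l
  have h0 := s.small_pos (n + 1)
  calc volume (s.good (n + 1) k)ᶜ
      ≤ (∑' m, volume (s.tower (n + 1 + m))ᶜ) + volume (s.level (n + 1) k) :=
        (measure_mono h).trans ((measure_union_le _ _).trans (by gcongr; exact measure_iUnion_le _))
    _ ≤ (∑' m, ENNReal.ofReal (s.small (n + 1 + m) / 2)) + ENNReal.ofReal (s.small (n + 1)) := by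
        gcongr with m
        · rw [add_right_comm]; exact volume_tower_compl_le _
        · exact volume_level_le _ _
    _ ≤ ENNReal.ofReal (s.small (n + 1)) + ENNReal.ofReal (s.small (n + 1)) := by
        gcongr; exact tsum_small n
    _ = _ := by rw [← ENNReal.ofReal_add h0.le h0.le, two_mul]

lemma tsum_ofReal_half (c : ℝ) : ∑' n : ℕ, ENNReal.ofReal (c * (1 / 2) ^ n) ≠ ⊤ := by
  by_cases hc : 0 ≤ c
  · rw [← ENNReal.ofReal_tsum_of_nonneg (fun n => by positivity)
      (summable_geometric_two.mul_left _)]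
    exact ENNReal.ofReal_ne_top
  · have : ∀ n : ℕ, ENNReal.ofReal (c * (1 / 2) ^ n) = 0 := fun n =>
      ENNReal.ofReal_of_nonpos (mul_nonpos_of_nonpos_of_nonneg (by linarith) (by positivity))
    simp only [this, tsum_zero, ne_eq, ENNReal.zero_ne_top, not_false_eq_true]

/-- Almost every point is eventually in the towers and outside of any given boundedly many
levels. -/
lemma ae_eventually_notMem_levels (J : ℕ → Finset ℕ) (L : ℕ) (hJ : ∀ n, (J n).card ≤ L) :
    ∀ᵐ x : AddCircle (1 : ℝ), ∀ᶠ n in atTop, x ∈ s.tower n ∧ ∀ k ∈ J n, x ∉ s.level n k := by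
  have key : ∀ n, volume ((s.tower (n + 1))ᶜ ∪ ⋃ k ∈ J (n + 1), s.level (n + 1) k) ≤
      ENNReal.ofReal ((1 + L) * (1 / 2) ^ n) := by
    intro n
    have h0 := s.small_pos (n + 1)
    calc _ ≤ ENNReal.ofReal (s.small (n + 1) / 2) +
          ∑ k ∈ J (n + 1), ENNReal.ofReal (s.small (n + 1)) := by
          refine (measure_union_le _ _).trans (add_le_add (volume_tower_compl_le n) ?_)
          exact (measure_biUnion_finset_le _ _).trans
            (Finset.sum_le_sum fun k _ => volume_level_le n k)
      _ = ENNReal.ofReal (s.small (n + 1) / 2 + (J (n + 1)).card * s.small (n + 1)) := by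
          rw [ENNReal.ofReal_add (by positivity) (by positivity),
            ENNReal.ofReal_mul (by positivity)]
          simp
      _ ≤ _ := by
          have h1 : ((J (n + 1)).card : ℝ) ≤ L := by exact_mod_cast hJ (n + 1)
          have h2 : s.small (n + 1) ≤ (1 / 2) ^ n :=
            (s.small_le (n + 1)).trans (pow_le_pow_of_le_one (by norm_num) (by norm_num) (by simp))
          refine ENNReal.ofReal_le_ofReal ?_
          calc s.small (n + 1) / 2 + (J (n + 1)).card * s.small (n + 1)
              ≤ s.small (n + 1) + L * s.small (n + 1) := by gcongr; linarith
            _ = (1 + L) * s.small (n + 1) := by ring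
            _ ≤ _ := by gcongr
  have := ae_eventually_notMem
    (ne_top_of_le_ne_top (tsum_ofReal_half (1 + L)) (ENNReal.tsum_le_tsum key))
  filter_upwards [this] with x hx
  rw [← map_add_atTop_eq_nat 1, eventually_map]
  filter_upwards [hx] with n hn
  simpa [not_or] using hn

lemma ae_mem_core : ∀ᵐ x : AddCircle (1 : ℝ), x ∈ s.core := by
  simp only [core, mem_ofPred_eq]
  refine ae_all_iff.2 fun L => ?_
  have hcard : ∀ n, ((Finset.range L ∪ Finset.Ico (s.H n - L) (s.H n)).image
      (s.ofOdo n)).card ≤ 2 * L := fun n => Finset.card_image_le.trans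
    ((Finset.card_union_le _ _).trans (by rw [Finset.card_range, Nat.card_Ico]; omega))
  filter_upwards [ae_eventually_notMem_levels _ _ hcard] with x hx
  filter_upwards [hx] with n hn
  have h1 := hn.2 (s.pos n x)
  have h2 := odo_lt hn.1
  have h3 : s.odo n x ∉ Finset.range L ∪ Finset.Ico (s.H n - L) (s.H n) := fun h =>
    h1 (by rw [← ofOdo_odo hn.1]; exact Finset.mem_image_of_mem _ h) (mem_level_pos hn.1)
  simp only [Finset.mem_union, Finset.mem_range, Finset.mem_Ico] at h3
  exact ⟨hn.1, by omega, by omega⟩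

lemma ae_eventually_pos_lt : ∀ᵐ x : AddCircle (1 : ℝ),
    ∀ᶠ n in atTop, x ∈ s.tower n ∧ s.pos n x + 1 < s.H n := by
  filter_upwards [ae_eventually_notMem_levels (fun n => {s.H n - 1}) 1 fun n => by simp] with x hx
  filter_upwards [hx] with n hn
  have h1 := pos_lt hn.1
  have h2 := mem_level_pos hn.1
  refine ⟨hn.1, lt_of_le_of_ne h1 fun h => hn.2 (s.H n - 1) (by simp) ?_⟩
  rwa [show s.H n - 1 = s.pos n x by omega]

end Scheme

lemma SmallOCbrt.exists_le {φ : ℝ → ℝ} (hφ : SmallOCbrt φ) :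
    ∃ C : ℝ, 0 ≤ C ∧ ∀ k : ℕ, φ k ≤ C + (k : ℝ) ^ ((1 : ℝ) / 3) := by
  have h := (hφ.eventually (gt_mem_nhds one_pos)).and (eventually_gt_atTop 0)
  obtain ⟨N, hN⟩ := eventually_atTop.1 (tendsto_natCast_atTop_atTop.eventually h)
  refine ⟨∑ k ∈ Finset.range N, |φ k|, by positivity, fun k => ?_⟩
  obtain hk | hk := lt_or_ge k N
  · have h1 : |φ k| ≤ ∑ k ∈ Finset.range N, |φ k| :=
      Finset.single_le_sum (f := fun k : ℕ => |φ k|) (fun _ _ => abs_nonneg _)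
        (Finset.mem_range.2 hk)
    have h2 : (0 : ℝ) ≤ (k : ℝ) ^ ((1 : ℝ) / 3) := by positivity
    linarith [le_abs_self (φ k)]
  · obtain ⟨h1, h2⟩ := hN k hk
    rw [div_lt_one (by positivity)] at h1
    have : 0 ≤ ∑ k ∈ Finset.range N, |φ k| := by positivity
    linarith

namespace Scheme

variable {θ : ℝ} {s : Scheme θ}

lemma exists_phi_le {φ : ℝ → ℝ} (hφ : SmallOCbrt φ) : ∃ C : ℝ, 0 ≤ C ∧
    ∀ (n : ℕ) (c : ℤ), |c| ≤ 2 * s.Q n ^ 2 → φ |(c : ℝ)| ≤ C * s.root n ^ 2 := by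
  obtain ⟨C, hC, h⟩ := hφ.exists_le
  refine ⟨C + 2, by positivity, fun n c hc => ?_⟩
  have h1 := s.one_le_root n
  have h2 : |(c : ℝ)| = (c.natAbs : ℝ) := by rw [Nat.cast_natAbs, Int.cast_abs]
  have h3 : (c.natAbs : ℝ) ≤ (2 * s.root n ^ 2) ^ 3 := by
    have : |(c : ℝ)| ≤ 2 * s.Q n ^ 2 := by exact_mod_cast hc
    rw [← h2]
    refine this.trans ?_
    rw [← s.root_pow n]
    nlinarith [pow_pos (s.root_pos n) 6]
  have h4 : (c.natAbs : ℝ) ^ ((1 : ℝ) / 3) ≤ 2 * s.root n ^ 2 := by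
    refine (Real.rpow_le_rpow (by positivity) h3 (by positivity)).trans (le_of_eq ?_)
    rw [← Real.rpow_natCast _ 3, ← Real.rpow_mul (by positivity)]
    norm_num
  rw [h2]
  have h5 : C ≤ C * s.root n ^ 2 := le_mul_of_one_le_right hC (one_le_pow₀ h1)
  linarith [h c.natAbs]

variable (s) in
lemma integrable_phi {φ : ℝ → ℝ} (hφ0 : ∀ t : ℝ, 0 ≤ t → 0 ≤ φ t) (hφ : SmallOCbrt φ)
    {c : AddCircle (1 : ℝ) → ℤ} (hc : Measurable c) (g : ℕ → ℕ)
    (hg : ∀ᵐ x : AddCircle (1 : ℝ), (∃ n, x ∈ s.good (n + 1) (g n)) ∧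
      ∀ n, x ∈ s.good (n + 1) (g n) → |c x| ≤ 2 * s.Q n ^ 2) :
    Integrable (fun x => φ |(c x : ℝ)|) := by
  obtain ⟨C, hC, h⟩ := s.exists_phi_le hφ
  refine ⟨((measurable_of_countable fun k : ℤ => φ |(k : ℝ)|).comp hc).aestronglyMeasurable, ?_⟩
  rw [hasFiniteIntegral_iff_ofReal (ae_of_all _ fun x => hφ0 _ (abs_nonneg _))]
  have key : ∀ᵐ x : AddCircle (1 : ℝ), ENNReal.ofReal (φ |(c x : ℝ)|) ≤
      ENNReal.ofReal (C * s.root 0 ^ 2) + ∑' n, (s.good (n + 1) (g n))ᶜ.indicator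
        (fun _ => ENNReal.ofReal (C * s.root (n + 1) ^ 2)) x := by
    filter_upwards [hg] with x hx
    classical
    have h1 := Nat.find_spec hx.1
    have h2 := fun m => Nat.find_min hx.1 (m := m)
    set N := Nat.find hx.1
    have h3 := ENNReal.ofReal_le_ofReal (h N (c x) (hx.2 N h1))
    cases hN : N with
    | zero => rw [hN] at h3; exact le_add_right h3
    | succ m =>
      rw [hN] at h3
      refine le_add_left (h3.trans ?_)
      refine le_trans (le_of_eq ?_) (ENNReal.le_tsum m)
      have h4 : x ∈ (s.good (m + 1) (g m))ᶜ := h2 m (by omega)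
      exact (indicator_of_mem h4 fun _ => ENNReal.ofReal (C * s.root (m + 1) ^ 2)).symm
  refine (lintegral_mono_ae key).trans_lt ?_
  rw [lintegral_add_left measurable_const, lintegral_const, measure_univ, mul_one,
    lintegral_tsum fun n =>
      (measurable_const.indicator (measurableSet_good _ _).compl).aemeasurable]
  refine ENNReal.add_lt_top.2 ⟨ENNReal.ofReal_lt_top, lt_top_iff_ne_top.2 ?_⟩
  refine ne_top_of_le_ne_top (tsum_ofReal_half (C * 2)) (ENNReal.tsum_le_tsum fun n => ?_)
  rw [lintegral_indicator_const (measurableSet_good _ _).compl]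
  have hr := s.root_pos (n + 1)
  calc _ ≤ ENNReal.ofReal (C * s.root (n + 1) ^ 2) * ENNReal.ofReal (2 * s.small (n + 1)) := by
        gcongr; exact volume_good_compl_le n _
    _ = ENNReal.ofReal (C * 2 * (1 / 2) ^ (n + 1)) := by
        rw [← ENNReal.ofReal_mul (by positivity), small]
        congr 1; field_simp
    _ ≤ _ := by
        refine ENNReal.ofReal_le_ofReal ?_
        gcongr ?_ * ?_
        exact pow_le_pow_of_le_one (by norm_num) (by norm_num) (by simp)

end Scheme

namespace Scheme

variable {θ : ℝ} {s : Scheme θ} {n : ℕ} {x y : AddCircle (1 : ℝ)}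

lemma measurePreserving_odometer : MeasurePreserving s.odometer volume volume := by
  refine ⟨s.odometer.measurable, Measure.ext fun A hA => ?_⟩
  rw [Measure.map_apply s.odometer.measurable hA]
  set D : ℤ → Set (AddCircle (1 : ℝ)) := fun c => s.odometer ⁻¹' A ∩ s.cocycle 1 ⁻¹' {c}
  have hD : ∀ c, MeasurableSet (D c) := fun c =>
    (s.odometer.measurable hA).inter (measurable_cocycle 1 (measurableSet_singleton c))
  have himage : ∀ c, (fun x => x + c • (θ : AddCircle (1 : ℝ))) '' D c = s.odometer '' D c :=
    fun c => image_congr fun x hx => by rw [← show s.cocycle 1 x = c from hx.2]; rfl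
  have hU : s.odometer ⁻¹' A = ⋃ c, D c := by ext x; simp [D]
  have hdisj : Pairwise (Function.onFun Disjoint D) := fun c d hcd =>
    disjoint_left.2 fun x hc hd => hcd (hc.2.symm.trans hd.2)
  calc volume (s.odometer ⁻¹' A) = ∑' c, volume (D c) := by rw [hU, measure_iUnion hdisj hD]
    _ = ∑' c, volume (s.odometer '' D c) := by
        refine tsum_congr fun c => ?_
        rw [← himage, image_add_right, measure_preimage_add_right]
    _ = volume (s.odometer '' ⋃ c, D c) := by
        rw [image_iUnion, measure_iUnion]
        · exact fun c d hcd => (disjoint_image_iff s.odometer.injective).2 (hdisj hcd)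
        · exact fun c => (MeasurableEquiv.measurableSet_image _).2 (hD c)
    _ = volume A := by rw [← hU, image_preimage_eq _ s.odometer.surjective]

variable (s) in
/-- The levels of the towers of the odometer. -/
def odoLevel (n k : ℕ) : Set (AddCircle (1 : ℝ)) :=
  {x | x ∈ s.core ∧ ∀ᶠ m in atTop, s.odo m x % s.H n = k}

lemma measurableSet_odoLevel (n k : ℕ) : MeasurableSet (s.odoLevel n k) :=
  measurableSet_core.inter <| measurableSet_eventually fun m =>
    measurable_odo m (MeasurableSet.of_discrete (s := {j | j % s.H n = k}))

lemma odoLevel_unique {k l : ℕ} (hk : x ∈ s.odoLevel n k) (hl : x ∈ s.odoLevel n l) : k = l := by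
  obtain ⟨m, h1, h2⟩ := (hk.2.and hl.2).exists
  exact h1.symm.trans h2

lemma mem_odoLevel_of_forall (hx : x ∈ s.core) (hm : ∀ m, n ≤ m → x ∈ s.tower m) :
    x ∈ s.odoLevel n (s.odo n x) :=
  ⟨hx, eventually_atTop.2 ⟨n, fun _ hnm => odo_mod_of_le hm hnm⟩⟩

lemma exists_mem_odoLevel (hx : x ∈ s.core) (n : ℕ) : ∃ k < s.H n, x ∈ s.odoLevel n k := by
  obtain ⟨N, hN⟩ := eventually_atTop.1 (eventually_mem_tower hx)
  refine ⟨s.odo (max n N) x % s.H n, Nat.mod_lt _ (s.H_pos n), hx, eventually_atTop.2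
    ⟨max n N, fun m hm => ?_⟩⟩
  rw [← odo_mod_of_le (n := max n N) (m := m) (fun m hm => hN m (by omega)) hm,
    Nat.mod_mod_of_dvd _ (s.H_dvd (le_max_left n N))]

lemma shift_mem_odoLevel {k l : ℕ} {d : ℤ} (hl : l < s.H n) (hd : (l : ℤ) = k + d)
    (hx : x ∈ s.odoLevel n k) : s.shift d x ∈ s.odoLevel n l := by
  refine ⟨shift_mem_core hx.1 d, ?_⟩
  filter_upwards [hx.2, eventually_odo_shift hx.1 d] with m h1 h2
  have h3 := Nat.div_add_mod' (s.odo m x) (s.H n)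
  have : s.odo m (s.shift d x) = s.odo m x / s.H n * s.H n + l := by omega
  rw [this, mul_add_mod_of_lt hl]

lemma image_odoLevel {j k : ℕ} (h : j + k < s.H n) :
    (⇑s.odometer)^[k] '' s.odoLevel n j = s.odoLevel n (j + k) := by
  refine Subset.antisymm ?_ fun y hy => ⟨s.shift (-k) y, ?_, ?_⟩
  · rintro _ ⟨x, hx, rfl⟩
    rw [odometer_iterate]
    exact shift_mem_odoLevel h (by push_cast; ring) hx
  · exact shift_mem_odoLevel (by omega) (by push_cast; ring) hy
  · rw [odometer_iterate, shift_shift, neg_add_cancel, shift_zero]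

variable (s) in
/-- The cutting parameters of the odometer. -/
def cutting (n : ℕ) : CSParam where
  q := s.K n * s.Q n
  two_le_q := by
    have h1 := s.K_large n
    have h2 := s.Q_pos n
    have h3 : 1 < 8 ^ (n + 4) := Nat.one_lt_pow (by omega) (by norm_num)
    nlinarith [Nat.mul_le_mul h3 (Nat.one_le_pow 2 _ h2)]
  σ := 0
  σ_eq_zero_of_gt _ _ := rfl

lemma σtot_cutting (n : ℕ) : (s.cutting n).σtot = 0 := by simp [CSParam.σtot, cutting]

lemma H_succ_eq_q_mul (n : ℕ) : s.H (n + 1) = (s.cutting n).q * s.H n := by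
  rw [s.H_succ, cutting]; ring

lemma heights_cutting (n : ℕ) : heights s.cutting n = s.H n := by
  induction n with
  | zero => rw [s.H_zero]; rfl
  | succ n ih => rw [heights, ih, σtot_cutting, H_succ_eq_q_mul, add_zero]

lemma prod_cutting (n : ℕ) : ∏ k ∈ Finset.range n, (s.cutting k).q = s.H n := by
  induction n with
  | zero => simp [s.H_zero]
  | succ n ih => rw [Finset.prod_range_succ, ih, H_succ_eq_q_mul, mul_comm]

lemma colStart_cutting (n i : ℕ) : colStart s.cutting n i = i * s.H n := by
  rw [colStart, heights_cutting]; simp [cutting]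

lemma mul_add_lt {i k : ℕ} (hi : i < (s.cutting n).q) (hk : k < s.H n) :
    i * s.H n + k < s.H (n + 1) := by
  calc i * s.H n + k < (i + 1) * s.H n := by rw [add_one_mul]; omega
    _ ≤ _ := by rw [H_succ_eq_q_mul]; gcongr; omega

lemma odoLevel_zero (n : ℕ) :
    s.odoLevel n 0 = ⋃ i ∈ Finset.range (s.cutting n).q, s.odoLevel (n + 1) (i * s.H n) := by
  have hdvd := s.H_dvd n.le_succ
  ext x
  simp only [mem_iUnion, Finset.mem_range, exists_prop]
  constructor
  · intro hx
    obtain ⟨l, hl, hxl⟩ := exists_mem_odoLevel hx.1 (n + 1)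
    obtain ⟨m, h1, h2⟩ := (hx.2.and hxl.2).exists
    have h3 : s.H n ∣ l := by
      rw [← h2, Nat.dvd_iff_mod_eq_zero, Nat.mod_mod_of_dvd _ hdvd, h1]
    obtain ⟨i, rfl⟩ := h3
    refine ⟨i, ?_, by rwa [mul_comm i]⟩
    rw [H_succ_eq_q_mul, mul_comm] at hl
    exact Nat.lt_of_mul_lt_mul_right hl
  · rintro ⟨i, -, hx⟩
    refine ⟨hx.1, hx.2.mono fun m hm => ?_⟩
    rw [← Nat.mod_mod_of_dvd _ hdvd, hm, Nat.mul_mod_left]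

lemma isCuttingStacking_odometer : IsCuttingStacking s.odometer s.cutting
    (fun n => s.odoLevel n 0) (fun n i => s.odoLevel (n + 1) (i * s.H n)) where
  meas_base n := measurableSet_odoLevel n 0
  meas_sub n i _ := measurableSet_odoLevel (n + 1) (i * s.H n)
  disj_levels n k hk l hl hkl := by
    rw [heights_cutting] at hk hl
    rw [image_odoLevel (by omega), image_odoLevel (by omega), disjoint_left]
    intro x hxk hxl
    have := odoLevel_unique hxk hxl
    omega
  disj_sub n i _ j _ hij := disjoint_left.2 fun x hxi hxj =>
    hij (Nat.eq_of_mul_eq_mul_right (s.H_pos n) (odoLevel_unique hxi hxj))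
  union_sub n := odoLevel_zero n
  subcolumn n i hi k hk := by
    rw [heights_cutting] at hk
    have := mul_add_lt hi hk
    rw [colStart_cutting, image_odoLevel (by omega), image_odoLevel this, zero_add]
  spacer_disjoint n l hl h := by
    rw [heights_cutting, H_succ_eq_q_mul] at hl
    refine absurd (Nat.div_add_mod' l (s.H n)).symm ?_
    rw [← colStart_cutting]
    refine h _ ((Nat.div_lt_iff_lt_mul (s.H_pos n)).2 hl) _ ?_
    rw [heights_cutting]
    exact Nat.mod_lt _ (s.H_pos n)

lemma eq_of_forall_odoLevel (hx : x ∈ s.core) (hy : y ∈ s.core)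
    (h : ∀ n, ∀ k < s.H n, x ∈ s.odoLevel n k → y ∈ s.odoLevel n k) : x = y := by
  obtain ⟨N, hN⟩ := eventually_atTop.1 ((eventually_mem_tower hx).and (eventually_mem_tower hy))
  refine eq_of_odo_eq (eventually_mem_tower hx) (eventually_mem_tower hy)
    (Eventually.frequently (eventually_atTop.2 ⟨N, fun n hn => ?_⟩))
  have h1 := mem_odoLevel_of_forall hx fun m hm => (hN m (hn.trans hm)).1
  have h2 := mem_odoLevel_of_forall hy fun m hm => (hN m (hn.trans hm)).2
  exact odoLevel_unique (h n _ (odo_lt (hN n hn).1) h1) h2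

lemma towersGenerate_odometer :
    TowersGenerate volume s.odometer s.cutting fun n => s.odoLevel n 0 := by
  intro A hA
  set G : Set (Set (AddCircle (1 : ℝ))) :=
    {t | ∃ n k, k < heights s.cutting n ∧ t = (⇑s.odometer)^[k] '' s.odoLevel n 0} with hG
  have hlevel : ∀ n, ∀ k < s.H n, s.odoLevel n k ∈ G := fun n k hk =>
    ⟨n, k, by rwa [heights_cutting], by rw [image_odoLevel (by omega), zero_add]⟩
  have hle : MeasurableSpace.generateFrom G ≤
      (inferInstance : MeasurableSpace (AddCircle (1 : ℝ))) := by
    refine MeasurableSpace.generateFrom_le ?_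
    rintro _ ⟨n, k, hk, rfl⟩
    rw [heights_cutting] at hk
    rw [image_odoLevel (by omega)]
    exact measurableSet_odoLevel n _
  let f : AddCircle (1 : ℝ) → ℕ × ℕ → Prop := fun x p => p.2 < s.H p.1 ∧ x ∈ s.odoLevel p.1 p.2
  have hf : Measurable[MeasurableSpace.generateFrom G] f := by
    refine @measurable_pi_lambda _ _ _ (MeasurableSpace.generateFrom G) _ f fun p => ?_
    refine (@measurableSet_setOfPred _ (MeasurableSpace.generateFrom G) _).1 ?_
    by_cases hp : p.2 < s.H p.1
    · simpa [f, hp] using MeasurableSpace.measurableSet_generateFrom (hlevel _ _ hp)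
    · simp [f, hp]
  have hinj : InjOn f s.core := fun x hx y hy hxy =>
    eq_of_forall_odoLevel hx hy fun n k hk hxk => ((congrFun hxy (n, k)).mp ⟨hk, hxk⟩).2
  have himage : MeasurableSet (f '' (A ∩ s.core)) :=
    (hA.inter measurableSet_core).image_of_measurable_injOn (hf.mono hle le_rfl)
      (hinj.mono inter_subset_right)
  refine ⟨f ⁻¹' (f '' (A ∩ s.core)), hf himage, ?_⟩
  have hcore : volume s.coreᶜ = 0 := ae_iff.1 ae_mem_core
  refine measure_mono_null ?_ hcore
  intro x hx hxc
  rcases hx with ⟨hxA, hx⟩ | ⟨⟨y, ⟨hyA, hyc⟩, hyx⟩, hxA⟩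
  · exact hx ⟨x, ⟨hxA, hxc⟩, rfl⟩
  · exact hxA (hinj hyc hxc hyx ▸ hyA)

lemma isUniversalOdometer_odometer : IsUniversalOdometer volume s.odometer := by
  refine ⟨s.cutting, ⟨measurePreserving_odometer, ?_, _, _, isCuttingStacking_odometer,
    towersGenerate_odometer⟩, fun _ _ => rfl, fun N hN => ⟨N, ?_⟩⟩
  · simp [CondF, σtot_cutting]
  · obtain ⟨m, rfl⟩ := Nat.exists_eq_succ_of_ne_zero hN.ne'
    rw [prod_cutting, s.H_succ, mul_assoc]
    exact dvd_mul_of_dvd_left (s.dvd m) _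

lemma zIter_rot (k : ℤ) (x : AddCircle (1 : ℝ)) :
    zIter (rot θ) k x = x + k • (θ : AddCircle (1 : ℝ)) := by
  have h1 : ∀ (k : ℕ) x, (⇑(rot θ))^[k] x = x + k • (θ : AddCircle (1 : ℝ)) := fun k x => by
    rw [show ⇑(rot θ) = ((θ : AddCircle (1 : ℝ)) + ·) from rfl, add_left_iterate,
      add_comm x]
  have h2 : ∀ (k : ℕ) x, (⇑(rot θ).symm)^[k] x = x - k • (θ : AddCircle (1 : ℝ)) := fun k x => by
    rw [show ⇑(rot θ).symm = (-(θ : AddCircle (1 : ℝ)) + ·) from rfl, add_left_iterate,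
      sub_eq_add_neg, ← smul_neg, add_comm x]
  rw [zIter]
  split_ifs with h
  · rw [h1, ← natCast_zsmul, Int.toNat_of_nonneg h]
  · rw [h2, ← natCast_zsmul, Int.toNat_of_nonneg (by omega), neg_smul, sub_neg_eq_add]

lemma add_eq_shift {c : ℤ} (hx : x ∈ s.core)
    (h : ∀ᶠ m in atTop, s.pos m x + 1 < s.H m ∧ s.rotDisp m x = c) :
    x + (θ : AddCircle (1 : ℝ)) = s.shift c x := by
  have key : ∀ᶠ m in atTop, x + (θ : AddCircle (1 : ℝ)) ∈ s.tower m ∧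
      (s.odo m (x + (θ : AddCircle (1 : ℝ))) : ℤ) = s.odo m x + c := by
    filter_upwards [h, eventually_mem_tower hx] with m hm hxm
    have h1 := s.add_mem_level (l := s.pos m x + 1) (d := 1) (mem_level_pos hxm) (by simp)
    rw [one_zsmul] at h1
    refine ⟨mem_tower_of_mem_level hm.1 h1, ?_⟩
    rw [odo, pos_eq hm.1 h1, ← hm.2, rotDisp, if_pos hm.1, odo]
    ring
  exact eq_shift hx (key.mono fun _ h => h.1) (key.mono fun _ h => h.2).frequently

lemma exists_eventually_rotDisp_eq
    (h : ∀ᶠ m in atTop, x ∈ s.tower m ∧ s.pos m x + 1 < s.H m) :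
    ∃ c, ∀ᶠ m in atTop, s.rotDisp m x = c := by
  obtain ⟨N, hN⟩ := eventually_atTop.1 h
  exact ⟨_, eventually_atTop.2 ⟨N, fun m hm =>
    (rotDisp_eq_of_le (fun m hm => (hN m hm).1) (hN N le_rfl).2 hm).2⟩⟩

lemma ae_exists_add_eq_shift : ∀ᵐ x : AddCircle (1 : ℝ),
    ∃ c, x + (θ : AddCircle (1 : ℝ)) = s.shift c x := by
  filter_upwards [ae_mem_core (s := s), ae_eventually_pos_lt (s := s)] with x hx hpos
  obtain ⟨c, hc⟩ := exists_eventually_rotDisp_eq hpos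
  exact ⟨c, add_eq_shift hx ((hpos.and hc).mono fun _ h => ⟨h.1.2, h.2⟩)⟩

lemma ae_orbit_eq : ∀ᵐ x : AddCircle (1 : ℝ), orbit (rot θ) x = orbit s.odometer x := by
  have h : ∀ᵐ x : AddCircle (1 : ℝ), ∀ k : ℤ, ∃ c,
      x + k • (θ : AddCircle (1 : ℝ)) + (θ : AddCircle (1 : ℝ)) =
        s.shift c (x + k • (θ : AddCircle (1 : ℝ))) :=
    ae_all_iff.2 fun k => (measurePreserving_add_right volume
      (k • (θ : AddCircle (1 : ℝ)))).quasiMeasurePreserving.ae (p := fun y =>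
        ∃ c, y + (θ : AddCircle (1 : ℝ)) = s.shift c y) ae_exists_add_eq_shift
  filter_upwards [h] with x hx
  refine Subset.antisymm ?_ ?_
  · have key : ∀ k : ℤ, ∃ d, s.shift d x = x + k • (θ : AddCircle (1 : ℝ)) := by
      intro k
      induction k using Int.induction_on with
      | zero => exact ⟨0, by rw [shift_zero, zero_smul, add_zero]⟩
      | succ k ih =>
        obtain ⟨d, hd⟩ := ih
        obtain ⟨c, hc⟩ := hx k
        exact ⟨d + c, by rw [← shift_shift, hd, ← hc, add_smul, one_smul, add_assoc]⟩
      | pred k ih =>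
        obtain ⟨d, hd⟩ := ih
        obtain ⟨c, hc⟩ := hx (-k - 1)
        refine ⟨d + -c, ?_⟩
        rw [← shift_shift, hd]
        have : x + (-(k : ℤ)) • (θ : AddCircle (1 : ℝ)) =
            s.shift c (x + (-(k : ℤ) - 1) • (θ : AddCircle (1 : ℝ))) := by
          rw [← hc, sub_smul, one_smul]; abel
        rw [this, shift_shift, add_neg_cancel, shift_zero]
    rintro _ ⟨k, rfl⟩
    obtain ⟨d, hd⟩ := key k
    exact ⟨d, by simp only [zIter_odometer, zIter_rot, hd]⟩
  · rintro _ ⟨d, rfl⟩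
    exact ⟨s.cocycle d x, by simp only [zIter_odometer, zIter_rot, shift]⟩

variable (s) in
lemma exists_measurable_rotCocycle : ∃ c : AddCircle (1 : ℝ) → ℤ, Measurable c ∧
    ∀ᵐ x : AddCircle (1 : ℝ), ∀ᶠ m in atTop, s.rotDisp m x = c x := by
  obtain ⟨c, hc, h⟩ := measurable_limit_of_tendsto_metrizable_ae (L := atTop)
    (μ := (volume : Measure (AddCircle (1 : ℝ))))
    (fun m => (measurable_rotDisp (s := s) m).aemeasurable) (by
      filter_upwards [ae_eventually_pos_lt (s := s)] with x hx
      obtain ⟨c, hc⟩ := exists_eventually_rotDisp_eq hx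
      exact ⟨c, tendsto_nhds_of_eventually_eq hc⟩)
  refine ⟨c, hc, h.mono fun x hx => ?_⟩
  rwa [nhds_discrete, tendsto_pure] at hx

lemma integrable_phi_cocycle {φ : ℝ → ℝ} (hφ0 : ∀ t : ℝ, 0 ≤ t → 0 ≤ φ t)
    (hφ : SmallOCbrt φ) : Integrable fun x => φ |(s.cocycle 1 x : ℝ)| := by
  refine s.integrable_phi hφ0 hφ (measurable_cocycle 1)
    (fun n => s.ofOdo (n + 1) (s.H (n + 1) - 1)) ?_
  filter_upwards [ae_mem_core (s := s)] with x hx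
  constructor
  · obtain ⟨N, hN⟩ := eventually_atTop.1 (hx 1)
    refine ⟨N, fun m hm => (hN m (by omega)).1, fun h => ?_⟩
    have h1 := odo_eq (Nat.sub_lt (s.H_pos _) one_pos) h
    have h2 := (hN (N + 1) (by omega)).2.2
    omega
  · rintro n ⟨h1, h2⟩
    have hxn := h1 (n + 1) le_rfl
    have h3 : s.odo (n + 1) x + 1 < s.H (n + 1) := by
      refine lt_of_le_of_ne (odo_lt hxn) fun h => h2 ?_
      rw [← h, Nat.add_sub_cancel, ofOdo_odo hxn]
      exact mem_level_pos hxn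
    have h4 : ∀ᶠ m in atTop, s.disp m 1 x = s.disp (n + 1) 1 x := eventually_atTop.2
      ⟨n + 1, fun m hm => (disp_eq_of_le h1 (by positivity) (by exact_mod_cast h3) hm).2⟩
    obtain ⟨m, h5, h6⟩ := (h4.and (eventually_disp_eq hx 1)).exists
    rw [← h6, h5, disp, if_pos ⟨by positivity, by exact_mod_cast h3⟩]
    exact s.abs_ofOdo_sub_le h3

lemma integrable_phi_rotCocycle {φ : ℝ → ℝ} (hφ0 : ∀ t : ℝ, 0 ≤ t → 0 ≤ φ t)
    (hφ : SmallOCbrt φ) {c : AddCircle (1 : ℝ) → ℤ} (hc : Measurable c)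
    (h : ∀ᵐ x : AddCircle (1 : ℝ), ∀ᶠ m in atTop, s.rotDisp m x = c x) :
    Integrable fun x => φ |(c x : ℝ)| := by
  refine s.integrable_phi hφ0 hφ hc (fun n => s.H (n + 1) - 1) ?_
  filter_upwards [h, ae_eventually_pos_lt (s := s)] with x hx hpos
  constructor
  · obtain ⟨N, hN⟩ := eventually_atTop.1 hpos
    refine ⟨N, fun m hm => (hN m (by omega)).1, fun h => ?_⟩
    have h1 := pos_eq (Nat.sub_lt (s.H_pos _) one_pos) h
    have h2 := (hN (N + 1) (by omega)).2
    omega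
  · rintro n ⟨h1, h2⟩
    have hxn := h1 (n + 1) le_rfl
    have h3 : s.pos (n + 1) x + 1 < s.H (n + 1) := by
      refine lt_of_le_of_ne (pos_lt hxn) fun h => h2 ?_
      rw [← h, Nat.add_sub_cancel]
      exact mem_level_pos hxn
    have h4 : ∀ᶠ m in atTop, s.rotDisp m x = s.rotDisp (n + 1) x :=
      eventually_atTop.2 ⟨n + 1, fun m hm => (rotDisp_eq_of_le h1 h3 hm).2⟩
    obtain ⟨m, h5, h6⟩ := (h4.and hx).exists
    rw [← h6, h5, rotDisp, if_pos h3]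
    exact s.abs_toOdo_sub_le n _

lemma phiIntegrablyOE {φ : ℝ → ℝ} (hφ0 : ∀ t : ℝ, 0 ≤ t → 0 ≤ φ t) (hφ : SmallOCbrt φ) :
    PhiIntegrablyOE volume (rot θ) volume s.odometer φ := by
  obtain ⟨c, hc, h⟩ := s.exists_measurable_rotCocycle
  refine ⟨.refl _, .id _, ?_, c, s.cocycle 1, hc, measurable_cocycle 1, ?_, ae_of_all _ fun y => ?_,
    integrable_phi_rotCocycle hφ0 hφ hc h, integrable_phi_cocycle hφ0 hφ⟩
  · filter_upwards [ae_orbit_eq (s := s)] with x hx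
    exact (image_id _).trans hx
  · filter_upwards [h, ae_mem_core (s := s), ae_eventually_pos_lt (s := s)] with x hx hcore hpos
    have := add_eq_shift hcore ((hpos.and hx).mono fun _ h => ⟨h.1.2, h.2⟩)
    rw [zIter_odometer]
    exact (add_comm _ _).trans this
  · rw [zIter_rot]; rfl

end Scheme

lemma standard_addCircle (T : AddCircle (1 : ℝ) ≃ᵐ AddCircle (1 : ℝ)) :
    MSystem.Standard ⟨AddCircle (1 : ℝ), volume, T⟩ := by
  refine ⟨inferInstanceAs (StandardBorelSpace (AddCircle (1 : ℝ))),
    inferInstanceAs (IsProbabilityMeasure (volume : Measure (AddCircle (1 : ℝ)))), ⟨fun x => ?_⟩⟩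
  have := AddCircle.volume_closedBall (T := 1) (x := x) 0
  simpa using this

/-- Let `φ : [0,∞) → [0,∞)` satisfy `φ(t) = o(t^{1/3})` as `t → ∞`.
Then the set of irrational numbers `θ` such that the irrational rotation `R_θ` is
`φ`-integrably orbit equivalent to the universal odometer is dense in `ℝ`. -/
theorem dense_irrational_angles_phi_OE_to_universal_odometer
    (φ : ℝ → ℝ) (hφ0 : ∀ t : ℝ, 0 ≤ t → 0 ≤ φ t) (hφ : SmallOCbrt φ) :
    Dense {θ : ℝ | Irrational θ ∧
      PhiOEToUnivOdometer (volume : Measure (AddCircle (1 : ℝ))) (rot θ) φ} := by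
  refine Metric.dense_iff.2 fun x ε hε => ?_
  obtain ⟨θ, hθ, ⟨s⟩⟩ := exists_scheme x hε
  exact ⟨θ, hθ, s.irrational, ⟨AddCircle (1 : ℝ), volume, s.odometer⟩, standard_addCircle _,
    s.isUniversalOdometer_odometer, s.phiIntegrablyOE hφ0 hφ⟩
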